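/- Let α ∈ (0,1), 1 ≤ p₀, p₁, q₀, q₁ ≤ ∞ and 0 ≤ t ≤ 1, and define p_t, q_t ∈ [1,∞] by 1/p_t = (1−t)/p₀ + t/p₁ and 1/q_t = (1−t)/q₀ + t/q₁ (with 1/∞ = 0). Then H_{p_t,q_t}(α) = (H_{p₀,q₀}(α))^{1−t} · (H_{p₁,q₁}(α))^{t}; in other words, the function (1/p, 1/q) ∈ [0,1]² ↦ log H_{p,q}(α) is affine. -/

import Mathlib

open MeasureTheory Complex Filter Set
open scoped Real ENNReal Topology

noncomputable section

def Strip : Set ℂ := {z : ℂ | 0 < z.im ∧ z.im < 1}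

def bLine (h : ℂ → ℂ) (y : ℝ) : ℝ → ℂ := fun x => h (x + y * Complex.I)

def hardyNorm (p q : ℝ≥0∞) (h : ℂ → ℂ) : ℝ≥0∞ :=
  ⨆ y ∈ Set.Ioo (0:ℝ) 1,
    ⨅ (f : ℝ → ℂ) (g : ℝ → ℂ) (_ : Measurable f) (_ : Measurable g)
      (_ : f + g = bLine h y),
      ENNReal.ofReal (1 - y)⁻¹ * eLpNorm f p volume +
        ENNReal.ofReal y⁻¹ * eLpNorm g q volume

def MemHardy (p q : ℝ≥0∞) (h : ℂ → ℂ) : Prop :=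
  DifferentiableOn ℂ h Strip ∧ hardyNorm p q h < ⊤

def IsTrace0 (h : ℂ → ℂ) (v : ℝ → ℂ) : Prop :=
  ∀ φ : SchwartzMap ℝ ℂ,
    Tendsto (fun y : ℝ => ∫ x : ℝ, h (x + y * Complex.I) * (starRingEnd ℂ) (φ x))
      (𝓝[>] (0:ℝ)) (𝓝 (∫ x : ℝ, v x * (starRingEnd ℂ) (φ x)))

def IsTrace1 (h : ℂ → ℂ) (w : ℝ → ℂ) : Prop :=
  ∀ φ : SchwartzMap ℝ ℂ,
    Tendsto (fun y : ℝ => ∫ x : ℝ, h (x + y * Complex.I) * (starRingEnd ℂ) (φ x))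
      (𝓝[<] (1:ℝ)) (𝓝 (∫ x : ℝ, w x * (starRingEnd ℂ) (φ x)))

def ratioSet (p q : ℝ≥0∞) (α : ℝ) : Set ℝ :=
  { r | ∃ (h : ℂ → ℂ) (h0 h1 : ℝ → ℂ), MemHardy p q h ∧ (∃ z ∈ Strip, h z ≠ 0) ∧
      IsTrace0 h h0 ∧ IsTrace1 h h1 ∧ MemLp h0 p volume ∧ MemLp h1 q volume ∧
      r = (eLpNorm (bLine h α) ⊤ volume).toReal /
        ((eLpNorm h0 p volume).toReal ^ (1 - α) * (eLpNorm h1 q volume).toReal ^ α) }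

/-- `H_{p,q}(α)`: the optimal value of the generalized three lines problem. -/
def Hval (p q : ℝ≥0∞) (α : ℝ) : ℝ := sSup (ratioSet p q α)

/-- widened strip -/
def Dst (δ : ℝ) : Set ℂ := {z : ℂ | -δ < z.im ∧ z.im < 1 + δ}

lemma convex_Dst (δ : ℝ) : Convex ℝ (Dst δ) := by
  exact (convex_Ioo (-δ) (1+δ)).linear_preimage Complex.imLm

lemma isOpen_Dst (δ : ℝ) : IsOpen (Dst δ) := by
  exact (isOpen_Ioo (a := -δ) (b := 1+δ)).preimage Complex.continuous_im

lemma sinh_re' (w : ℂ) : (Complex.sinh w).re = Real.sinh w.re * Real.cos w.im := by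
  conv_lhs => rw [← Complex.re_add_im w, Complex.sinh_add, Complex.sinh_mul_I, Complex.cosh_mul_I]
  simp [Complex.sinh_ofReal_re, Complex.cosh_ofReal_re, Complex.sin_ofReal_re, Complex.cos_ofReal_re]

lemma sinh_im' (w : ℂ) : (Complex.sinh w).im = Real.cosh w.re * Real.sin w.im := by
  conv_lhs => rw [← Complex.re_add_im w, Complex.sinh_add, Complex.sinh_mul_I, Complex.cosh_mul_I]
  simp [Complex.sinh_ofReal_re, Complex.cosh_ofReal_re, Complex.sin_ofReal_re, Complex.cos_ofReal_re]

lemma cosh_re' (w : ℂ) : (Complex.cosh w).re = Real.cosh w.re * Real.cos w.im := by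
  conv_lhs => rw [← Complex.re_add_im w, Complex.cosh_add, Complex.sinh_mul_I, Complex.cosh_mul_I]
  simp [Complex.sinh_ofReal_re, Complex.cosh_ofReal_re, Complex.sin_ofReal_re, Complex.cos_ofReal_re]

lemma cosh_im' (w : ℂ) : (Complex.cosh w).im = Real.sinh w.re * Real.sin w.im := by
  conv_lhs => rw [← Complex.re_add_im w, Complex.cosh_add, Complex.sinh_mul_I, Complex.cosh_mul_I]
  simp [Complex.sinh_ofReal_re, Complex.cosh_ofReal_re, Complex.sin_ofReal_re, Complex.cos_ofReal_re]

lemma sinh_normSq (w : ℂ) : ‖Complex.sinh w‖^2 = Real.sinh w.re ^ 2 + Real.sin w.im ^ 2 := by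
  rw [Complex.sq_norm, Complex.normSq_apply, sinh_re', sinh_im']
  nlinarith [Real.cosh_sq w.re, Real.sin_sq_add_cos_sq w.im]

lemma cosh_normSq (w : ℂ) : ‖Complex.cosh w‖^2 = Real.cosh w.re ^ 2 - Real.sin w.im ^ 2 := by
  rw [Complex.sq_norm, Complex.normSq_apply, cosh_re', cosh_im']
  nlinarith [Real.cosh_sq w.re, Real.sin_sq_add_cos_sq w.im]

lemma sinh_ne_zero' {w : ℂ} (h0 : w ≠ 0) (h : |w.im| < π) : Complex.sinh w ≠ 0 := by
  intro hs
  have h1 := sinh_normSq w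
  rw [hs] at h1
  have h2 : Real.sinh w.re ^ 2 = 0 := by
    have := sq_nonneg (Real.sinh w.re); have := sq_nonneg (Real.sin w.im)
    simp at h1; nlinarith
  have h3 : Real.sin w.im ^ 2 = 0 := by simp at h1; nlinarith
  have h4 : w.re = 0 := by simpa using h2
  have h5 : Real.sin w.im = 0 := by simpa using h3
  rw [abs_lt] at h
  have h6 := (Real.sin_eq_zero_iff_of_lt_of_lt h.1 h.2).1 h5
  exact h0 (Complex.ext h4 h6)

/-- `w coth w`, holomorphic for `|im w| < π`. -/
def UU (w : ℂ) : ℂ := Complex.cosh w / dslope Complex.sinh 0 w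

lemma dslope_sinh_ne {w : ℂ} (h : |w.im| < π) : dslope Complex.sinh 0 w ≠ 0 := by
  by_cases h0 : w = 0
  · subst h0; simp [dslope_same, (Complex.hasDerivAt_sinh 0).deriv]
  · rw [dslope_of_ne _ h0, slope_def_field]
    simp [sinh_ne_zero' h0 h, h0]

lemma UU_eq {w : ℂ} (h0 : w ≠ 0) : UU w = w * (Complex.cosh w / Complex.sinh w) := by
  rw [UU, dslope_of_ne _ h0, slope_def_field]
  simp
  field_simp

lemma UU_diff : DifferentiableOn ℂ UU {w : ℂ | |w.im| < π} := by
  apply DifferentiableOn.div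
  · exact Complex.differentiable_cosh.differentiableOn
  · have : DifferentiableOn ℂ (dslope Complex.sinh 0) univ :=
      (Complex.differentiableOn_dslope univ_mem).2 Complex.differentiable_sinh.differentiableOn
    exact this.mono (subset_univ _)
  · intro w hw; exact dslope_sinh_ne hw

lemma UU_bound (η : ℝ) (hη : 0 < η) :
    ∃ C, 0 ≤ C ∧ ∀ w : ℂ, |w.im| ≤ π * (1 - η) → ‖UU w‖ ≤ C * (1 + ‖w‖) := by
  have hK : IsCompact ((Icc (-1:ℝ) 1) ×ℂ (Icc (-(π * (1 - η))) (π * (1 - η)))) :=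
    isCompact_Icc.reProdIm isCompact_Icc
  have hc : ContinuousOn UU ((Icc (-1:ℝ) 1) ×ℂ (Icc (-(π * (1 - η))) (π * (1 - η)))) := by
    apply UU_diff.continuousOn.mono
    intro w hw
    have := hw.2
    simp only [mem_preimage, mem_Icc] at this
    have h2 : |w.im| ≤ π * (1 - η) := abs_le.2 this
    have : π * (1-η) < π := by nlinarith [Real.pi_pos]
    exact lt_of_le_of_lt h2 this
  obtain ⟨C, hC⟩ := hK.exists_bound_of_continuousOn hc
  have hs1 : 0 < Real.sinh 1 := by simp
  refine ⟨max C 0 + Real.cosh 1 / Real.sinh 1, by positivity, fun w hw => ?_⟩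
  have hw0 := norm_nonneg w
  have hcs : 0 ≤ Real.cosh 1 / Real.sinh 1 := by positivity
  have hm : 0 ≤ max C 0 := le_max_right _ _
  by_cases h1 : |w.re| ≤ 1
  · have := hC w ⟨abs_le.1 h1, abs_le.1 hw⟩
    have := le_max_left C 0
    nlinarith
  · push Not at h1
    have hwne : w ≠ 0 := by rintro rfl; simp at h1; linarith
    rw [UU_eq hwne, norm_mul, norm_div]
    have hsq : ‖Complex.cosh w‖ / ‖Complex.sinh w‖ ≤ Real.cosh 1 / Real.sinh 1 := by
      have hcn := cosh_normSq w
      have hsn := sinh_normSq w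
      have e1 : Real.sinh 1 ^ 2 ≤ Real.sinh w.re ^ 2 := by
        rw [sq_le_sq, Real.abs_sinh, Real.abs_sinh]
        apply Real.sinh_le_sinh.2; simpa using h1.le
      have hspos : 0 < ‖Complex.sinh w‖ := by
        by_contra hcon
        have : ‖Complex.sinh w‖ = 0 := le_antisymm (not_lt.1 hcon) (norm_nonneg _)
        rw [this] at hsn
        nlinarith [sq_nonneg (Real.sin w.im)]
      rw [div_le_div_iff₀ hspos hs1]
      apply le_of_sq_le_sq _ (by positivity)
      rw [mul_pow, mul_pow, hcn, hsn, Real.cosh_sq, Real.cosh_sq]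
      nlinarith [sq_nonneg (Real.sin w.im), sq_nonneg (Real.sinh 1)]
    nlinarith [mul_le_mul_of_nonneg_left hsq hw0]

lemma UU_zero : UU 0 = 1 := by
  simp [UU, dslope_same, (Complex.hasDerivAt_sinh 0).deriv]

lemma UU_conj (w : ℂ) : UU ((starRingEnd ℂ) w) = (starRingEnd ℂ) (UU w) := by
  by_cases h : w = 0
  · subst h; simp [UU_zero]
  · have h' : (starRingEnd ℂ) w ≠ 0 := by simpa using h
    rw [UU_eq h, UU_eq h', Complex.cosh_conj, Complex.sinh_conj]; simp

lemma coth_re (w : ℂ) : (Complex.cosh w / Complex.sinh w).re =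
    Real.sinh w.re * Real.cosh w.re / (Real.sinh w.re ^ 2 + Real.sin w.im ^ 2) := by
  rw [Complex.div_re, ← Complex.sq_norm, sinh_normSq, sinh_re', sinh_im', cosh_re', cosh_im',
    ← add_div]
  congr 1
  linear_combination (Real.sinh w.re * Real.cosh w.re) * (Real.sin_sq_add_cos_sq w.im)

lemma reDeriv {Φ : ℂ → ℂ} {d : ℂ} {x : ℝ} {y : ℂ} (h : HasDerivAt Φ d (x + y)) :
    HasDerivAt (fun x : ℝ => (Φ (x + y)).re) d.re x := by
  have := HasDerivAt.comp_add_const (x : ℂ) y h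
  exact this.real_of_complex

lemma A_pos {β : ℝ} (hβ : β ∈ Ioo (0:ℝ) 1) (x : ℝ) : 0 < Real.cosh (π * x) - Real.cos (π * β) := by
  have h1 : Real.cos (π * β) < Real.cos 0 :=
    Real.cos_lt_cos_of_nonneg_of_le_pi le_rfl (by nlinarith [Real.pi_pos, hβ.2])
      (mul_pos Real.pi_pos hβ.1)
  rw [Real.cos_zero] at h1
  linarith [Real.one_le_cosh (π * x)]

theorem exists_outer (β : ℝ) (hβ : β ∈ Ioo (0:ℝ) 1) : ∃ Φ : ℂ → ℂ, ∃ c : ℝ, 0 < c ∧ ∃ C : ℝ, 0 ≤ C ∧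
    DifferentiableOn ℂ Φ (Dst (β/2)) ∧ (∀ x : ℝ, (Φ (x + I)).re = 0) ∧
    (∀ x : ℝ, (Φ x).re = Real.log (c * (Real.cosh (π * x) - Real.cos (π * β)))) ∧
    ∀ z ∈ Dst (β/2), |(Φ z).re| ≤ C * (1 + |z.re|) := by
  obtain ⟨hβ0, hβ1⟩ := hβ
  have hpi := Real.pi_pos
  set W1 : ℂ → ℂ := fun z => (π/2 : ℝ) * (z - β * I) with hW1
  set W2 : ℂ → ℂ := fun z => (π/2 : ℝ) * (z + (β - 2) * I) with hW2
  have im1 : ∀ z, (W1 z).im = π/2 * (z.im - β) := by intro z; simp only [hW1, Complex.im_ofReal_mul]; simp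
  have im2 : ∀ z, (W2 z).im = π/2 * (z.im + (β - 2)) := by
    intro z; simp only [hW2, Complex.im_ofReal_mul]; simp
  have re1 : ∀ z, (W1 z).re = π/2 * z.re := by intro z; simp only [hW1, Complex.re_ofReal_mul]; simp
  have re2 : ∀ z, (W2 z).re = π/2 * z.re := by intro z; simp only [hW2, Complex.re_ofReal_mul]; simp
  have b1 : ∀ z ∈ Dst (β/2), |(W1 z).im| ≤ π * (1 - β/4) := by
    intro z hz
    obtain ⟨h1, h2⟩ := hz
    rw [im1, abs_le]; constructor <;> nlinarith
  have b2 : ∀ z ∈ Dst (β/2), |(W2 z).im| ≤ π * (1 - β/4) := by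
    intro z hz
    obtain ⟨h1, h2⟩ := hz
    rw [im2, abs_le]; constructor <;> nlinarith
  have hlt : π * (1 - β/4) < π := by nlinarith
  set F : ℂ → ℂ := fun z => I * (UU (W1 z) + UU (W2 z)) with hF
  have hFd : DifferentiableOn ℂ F (Dst (β/2)) := by
    apply DifferentiableOn.const_mul
    apply DifferentiableOn.add
    · exact UU_diff.comp (by fun_prop) (fun z hz => lt_of_le_of_lt (b1 z hz) hlt)
    · exact UU_diff.comp (by fun_prop) (fun z hz => lt_of_le_of_lt (b2 z hz) hlt)
  obtain ⟨Φ0, hΦ0⟩ := (convex_Dst (β/2)).exists_forall_hasDerivWithinAt hFd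
  set Φ : ℂ → ℂ := fun z => Φ0 z - Φ0 I with hΦ
  have hder : ∀ z ∈ Dst (β/2), HasDerivAt Φ (F z) z := fun z hz =>
    ((hΦ0 z hz).hasDerivAt ((isOpen_Dst _).mem_nhds hz)).sub_const _
  have mem1 : ∀ x : ℝ, (x + I : ℂ) ∈ Dst (β/2) := by
    intro x; simp [Dst]; constructor <;> linarith
  have mem0 : ∀ x : ℝ, (x : ℂ) ∈ Dst (β/2) := by
    intro x; simp [Dst]; constructor <;> linarith
  -- line 1
  have line1 : ∀ x : ℝ, (Φ (x + I)).re = 0 := by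
    have hd : ∀ x : ℝ, HasDerivAt (fun x : ℝ => (Φ (x + I)).re) 0 x := by
      intro x
      have := reDeriv (hder _ (mem1 x))
      convert this using 1
      have e : W2 (x + I) = (starRingEnd ℂ) (W1 (x + I)) := by
        apply Complex.ext
        · rw [Complex.conj_re, re1, re2]
        · rw [Complex.conj_im, im1, im2]; simp; ring
      simp only [hF, e, UU_conj]
      simp
    have hc := is_const_of_deriv_eq_zero (fun x => (hd x).differentiableAt) (fun x => (hd x).deriv)
    intro x
    have := hc x 0
    simpa [hΦ] using this
  -- line 0
  have line0 : ∀ x : ℝ, HasDerivAt (fun x : ℝ => (Φ x).re -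
      Real.log (Real.cosh (π * x) - Real.cos (π * β))) 0 x := by
    intro x
    have h1 : HasDerivAt (fun x : ℝ => (Φ x).re) (F x).re x := (hder _ (mem0 x)).real_of_complex
    have hA := A_pos ⟨hβ0, hβ1⟩ x
    have h2 : HasDerivAt (fun x : ℝ => Real.log (Real.cosh (π * x) - Real.cos (π * β)))
        ((Real.sinh (π * x) * (π * 1)) / (Real.cosh (π * x) - Real.cos (π * β))) x :=
      (((hasDerivAt_id x).const_mul π).cosh.sub_const _).log hA.ne'
    have h12 := h1.sub h2
    suffices hE : (F x).re - (Real.sinh (π * x) * (π * 1)) / (Real.cosh (π * x) - Real.cos (π * β)) = 0 by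
      rw [hE] at h12; exact h12
    set w := W1 x with hw
    have hwre : w.re = π * x / 2 := by
      simp only [hw, hW1, Complex.re_ofReal_mul]; simp; ring
    have hwim : w.im = - (π * β / 2) := by rw [hw, im1]; simp; ring
    have hw0 : w ≠ 0 := by
      intro h; rw [h] at hwim; simp at hwim; rcases hwim with h | h <;> linarith
    have e : W2 x = (starRingEnd ℂ) w - π * I := by
      apply Complex.ext
      · rw [re2, Complex.sub_re, Complex.conj_re, hw, re1]; simp
      · rw [im2]; simp [hwim]; ring
    have hw20 : W2 x ≠ 0 := by
      intro h
      have := im2 x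
      rw [h] at this; simp only [Complex.zero_im, Complex.ofReal_im] at this; nlinarith
    have key : UU (W2 x) = UU ((starRingEnd ℂ) w) - π * I *
        (Complex.cosh ((starRingEnd ℂ) w) / Complex.sinh ((starRingEnd ℂ) w)) := by
      rw [UU_eq hw20, UU_eq (by simpa using hw0), e, Complex.cosh_sub, Complex.sinh_sub,
        Complex.cosh_mul_I, Complex.sinh_mul_I]
      simp
      ring
    have hFx : (F x).re = π * (Complex.cosh w / Complex.sinh w).re := by
      have : (F x) = I * (UU w + UU ((starRingEnd ℂ) w)) + π * (starRingEnd ℂ) (Complex.cosh w / Complex.sinh w) := by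
        simp only [hF, key, ← hw, map_div₀, ← Complex.cosh_conj, ← Complex.sinh_conj]
        linear_combination (-π * (cosh ((starRingEnd ℂ) w) / sinh ((starRingEnd ℂ) w))) * I_sq
      rw [this, UU_conj, Complex.add_re, Complex.re_ofReal_mul, Complex.conj_re]
      simp
    rw [hFx, coth_re, hwre, hwim]
    have s1 : Real.sinh (π * x) = 2 * Real.sinh (π * x / 2) * Real.cosh (π * x / 2) := by
      rw [← Real.sinh_two_mul]; congr 1; ring
    have s2 : Real.cosh (π * x) - Real.cos (π * β) =
        2 * (Real.sinh (π * x / 2) ^ 2 + Real.sin (-(π * β / 2)) ^ 2) := by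
      have a1 : Real.cosh (π * x) = Real.cosh (2 * (π * x / 2)) := by congr 1; ring
      have a2 : Real.cos (π * β) = Real.cos (2 * (π * β / 2)) := by congr 1; ring
      rw [a1, a2, Real.cosh_two_mul, Real.cos_two_mul, Real.cosh_sq, Real.sin_neg, neg_sq, Real.sin_sq]
      ring
    rw [s2] at hA ⊢
    rw [s1]
    have hA' : (Real.sinh (π * x / 2) ^ 2 + Real.sin (-(π * β / 2)) ^ 2) ≠ 0 := by
      intro h; rw [h] at hA; simp at hA
    field_simp
    ring
  have hc0 := is_const_of_deriv_eq_zero (fun x => (line0 x).differentiableAt) (fun x => (line0 x).deriv)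
  obtain ⟨C, hC0, hC⟩ := UU_bound (β/4) (by linarith)
  refine ⟨Φ, Real.exp ((Φ (0:ℝ)).re - Real.log (Real.cosh (π * 0) - Real.cos (π * β))),
    Real.exp_pos _, 36 * C, by positivity, fun z hz => (hder z hz).differentiableAt.differentiableWithinAt,
    line1, ?_, ?_⟩
  · intro x
    rw [Real.log_mul (Real.exp_pos _).ne' (A_pos ⟨hβ0, hβ1⟩ x).ne', Real.log_exp]
    have := hc0 x 0
    linarith
  · intro z hz
    set S : Set ℂ := {w | w.re = z.re} ∩ Dst (β/2)
    have hS : Convex ℝ S := by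
      apply Convex.inter _ (convex_Dst _)
      exact (convex_singleton z.re).linear_preimage Complex.reLm
    have pi4 := Real.pi_lt_four
    have bound : ∀ w ∈ S, ‖F w‖ ≤ 2 * C * (1 + 2 * (|z.re| + 4)) := by
      rintro w ⟨hw1, hw2⟩
      have hw1 : w.re = z.re := hw1
      have hwim : |w.im| ≤ 2 := by rw [abs_le]; constructor <;> linarith [hw2.1, hw2.2]
      have hwn : ‖w‖ ≤ |z.re| + 2 := by
        have := Complex.norm_le_abs_re_add_abs_im w
        rw [hw1] at this; linarith
      have n1 : ‖W1 w‖ ≤ 2 * (|z.re| + 4) := by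
        simp only [hW1, norm_mul, Complex.norm_real, Real.norm_eq_abs]
        rw [abs_of_pos (by positivity)]
        have : ‖w - β * I‖ ≤ |z.re| + 4 := by
          refine (norm_sub_le _ _).trans ?_
          simp [abs_of_pos hβ0]; linarith
        nlinarith [norm_nonneg (w - β * I)]
      have n2 : ‖W2 w‖ ≤ 2 * (|z.re| + 4) := by
        simp only [hW2, norm_mul, Complex.norm_real, Real.norm_eq_abs]
        rw [abs_of_pos (by positivity)]
        have : ‖w + (β - 2) * I‖ ≤ |z.re| + 4 := by
          refine (norm_add_le _ _).trans ?_
          have : ‖((β:ℂ) - 2) * I‖ ≤ 2 := by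
            have : ((β:ℂ) - 2) = ((β - 2 : ℝ) : ℂ) := by push_cast; ring
            rw [norm_mul, this, Complex.norm_real, Real.norm_eq_abs, Complex.norm_I, mul_one, abs_le]
            constructor <;> linarith
          linarith
        nlinarith [norm_nonneg (w + (β - 2) * I)]
      simp only [hF, norm_mul, Complex.norm_I, one_mul]
      have u1 := hC _ (b1 w hw2)
      have u2 := hC _ (b2 w hw2)
      have := norm_add_le (UU (W1 w)) (UU (W2 w))
      nlinarith
    have hx1 : ((z.re : ℂ) + I) ∈ S := ⟨by simp, mem1 _⟩
    have := hS.norm_image_sub_le_of_norm_hasDerivWithin_le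
      (fun w hw => (hder w hw.2).hasDerivWithinAt) bound hx1 ⟨rfl, hz⟩
    have hn : ‖z - (z.re + I)‖ ≤ 2 := by
      have : z - (z.re + I) = ((z.im - 1 : ℝ) : ℂ) * I := by
        apply Complex.ext <;> simp
      rw [this, norm_mul, Complex.norm_real, Complex.norm_I, mul_one, Real.norm_eq_abs, abs_le]
      constructor <;> linarith [hz.1, hz.2]
    have h3 : |(Φ z).re| ≤ ‖Φ z - Φ (z.re + I)‖ := by
      have := Complex.abs_re_le_norm (Φ z - Φ (z.re + I))
      rwa [Complex.sub_re, line1, sub_zero] at this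
    have h4 : 2 * C * (1 + 2 * (|z.re| + 4)) * ‖z - (z.re + I)‖ ≤ 2 * C * (1 + 2 * (|z.re| + 4)) * 2 := by
      gcongr
    have := abs_nonneg z.re
    nlinarith

lemma integrable_wt : Integrable (fun x : ℝ => Real.exp (-|x|)) := by
  refine (integrable_inv_one_add_sq.const_mul 2).mono' (by fun_prop) (ae_of_all _ fun x => ?_)
  rw [Real.norm_eq_abs, abs_of_pos (Real.exp_pos _), Real.exp_neg]
  have := Real.quadratic_le_exp_of_nonneg (abs_nonneg x)
  rw [sq_abs] at this
  rw [← div_eq_mul_inv, ← one_div, div_le_div_iff₀ (Real.exp_pos _) (by positivity)]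
  nlinarith [abs_nonneg x]

lemma eLpNorm_weight {p : ℝ≥0∞} (hp : 1 ≤ p) {A : ℝ → ℝ} (hA : ∀ x, 0 < A x)
    (hI : Integrable (fun x => (A x)⁻¹)) {f : ℝ → ℂ} {B : ℝ} (hB : 0 ≤ B)
    (hf : ∀ x, ‖f x‖ ≤ B * (A x) ^ (-(p⁻¹).toReal)) :
    eLpNorm f p volume ≤ ENNReal.ofReal (B * (∫ x, (A x)⁻¹) ^ (p⁻¹).toReal) := by
  by_cases htop : p = ⊤
  · subst htop
    rw [eLpNorm_exponent_top]
    have : ∀ᵐ x ∂(volume : Measure ℝ), ‖f x‖ ≤ B := ae_of_all _ fun x => by simpa using hf x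
    simpa using eLpNormEssSup_le_of_ae_bound this
  · have hp0 : p ≠ 0 := by rintro rfl; simp at hp
    set r := p.toReal with hr
    have hr0 : 0 < r := ENNReal.toReal_pos hp0 htop
    have hinv : (p⁻¹).toReal = r⁻¹ := by rw [ENNReal.toReal_inv]
    rw [hinv] at hf ⊢
    rw [eLpNorm_eq_lintegral_rpow_enorm_toReal hp0 htop, ← hr]
    have hm : 0 ≤ ∫ x, (A x)⁻¹ := integral_nonneg fun x => (inv_pos.2 (hA x)).le
    have h1 : ∫⁻ x, ‖f x‖ₑ ^ r ≤ ENNReal.ofReal (B ^ r * ∫ x, (A x)⁻¹) := by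
      rw [← integral_const_mul, ofReal_integral_eq_lintegral_ofReal (hI.const_mul _)
        (ae_of_all _ fun x => mul_nonneg (by positivity) (inv_pos.2 (hA x)).le)]
      apply lintegral_mono
      intro x
      simp only
      rw [← ofReal_norm_eq_enorm, ENNReal.ofReal_rpow_of_nonneg (norm_nonneg _) hr0.le]
      apply ENNReal.ofReal_le_ofReal
      calc ‖f x‖ ^ r ≤ (B * (A x) ^ (-r⁻¹)) ^ r := by gcongr; exact hf x
        _ = B ^ r * (A x)⁻¹ := by
          rw [Real.mul_rpow hB (Real.rpow_nonneg (hA x).le _), ← Real.rpow_mul (hA x).le,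
            neg_mul, inv_mul_cancel₀ hr0.ne', Real.rpow_neg_one]
    calc (∫⁻ x, ‖f x‖ₑ ^ r) ^ (1 / r) ≤ (ENNReal.ofReal (B ^ r * ∫ x, (A x)⁻¹)) ^ (1/r) := by gcongr
      _ = ENNReal.ofReal (B * (∫ x, (A x)⁻¹) ^ r⁻¹) := by
        rw [ENNReal.ofReal_rpow_of_nonneg (by positivity) (by positivity),
          Real.mul_rpow (by positivity) hm, ← Real.rpow_mul hB, one_div, mul_inv_cancel₀ hr0.ne',
          Real.rpow_one]

lemma toReal_inv_le_one {p : ℝ≥0∞} (hp : 1 ≤ p) : (p⁻¹).toReal ≤ 1 := by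
  have : p⁻¹ ≤ 1 := by simpa using hp
  simpa using ENNReal.toReal_mono (by simp) this

lemma eLpNorm_wt_lt_top {p : ℝ≥0∞} (hp : 1 ≤ p) {f : ℝ → ℂ} {B : ℝ} (hB : 0 ≤ B)
    (hf : ∀ x, ‖f x‖ ≤ B * Real.exp (-|x|)) :
    eLpNorm f p volume ≤ ENNReal.ofReal (B * (∫ x : ℝ, Real.exp (-|x|)) ^ (p⁻¹).toReal) := by
  have e : (fun x : ℝ => Real.exp (-|x|)) = fun x => (Real.exp |x|)⁻¹ := by
    ext x; rw [Real.exp_neg]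
  rw [e]
  apply eLpNorm_weight hp (fun x => Real.exp_pos _) (by rw [← e]; exact integrable_wt) hB
  intro x
  refine (hf x).trans ?_
  gcongr
  rw [← Real.exp_mul]
  apply Real.exp_le_exp.2
  nlinarith [abs_nonneg x, toReal_inv_le_one hp]

def dd (α : ℝ) (z : ℂ) : ℂ := Complex.cosh (π * z) - (Real.cos (π * α) : ℝ)

lemma dd_diff (α : ℝ) : Differentiable ℂ (dd α) := by
  unfold dd; fun_prop

lemma dd_normSq (α : ℝ) (z : ℂ) : ‖dd α z‖ ^ 2 =
    (Real.cosh (π * z.re) - Real.cos (π * (z.im - α))) *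
    (Real.cosh (π * z.re) - Real.cos (π * (z.im + α))) := by
  rw [Complex.sq_norm, Complex.normSq_apply, dd, Complex.sub_re, Complex.sub_im, cosh_re', cosh_im']
  simp only [Complex.re_ofReal_mul, Complex.im_ofReal_mul, Complex.ofReal_re, Complex.ofReal_im]
  rw [mul_sub π z.im α, mul_add π z.im α, Real.cos_sub, Real.cos_add]
  have h1 := Real.cosh_sq (π * z.re)
  have h2 := Real.sin_sq_add_cos_sq (π * z.im)
  have h3 := Real.sin_sq_add_cos_sq (π * α)
  generalize Real.cosh (π * z.re) = C at *
  generalize Real.sinh (π * z.re) = S at *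
  generalize Real.cos (π * z.im) = c at *
  generalize Real.sin (π * z.im) = s at *
  generalize Real.cos (π * α) = k at *
  generalize Real.sin (π * α) = l at *
  have hS : S^2 = C^2 - 1 := by linarith
  have hs : s^2 = 1 - c^2 := by linarith
  have hl : l^2 = 1 - k^2 := by linarith
  linear_combination s^2 * hS + (C^2 - 1) * hs  + (s^2) * hl + (1-k^2) * hs

lemma dd_lower {α ρ : ℝ} {z : ℂ} (hρ : ρ ≤ 1)
    (h1 : Real.cos (π * (z.im - α)) ≤ ρ * Real.cosh (π * z.re))
    (h2 : Real.cos (π * (z.im + α)) ≤ ρ * Real.cosh (π * z.re)) :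
    (1 - ρ) * Real.cosh (π * z.re) ≤ ‖dd α z‖ := by
  apply le_of_sq_le_sq _ (norm_nonneg _)
  rw [dd_normSq]
  have := Real.cosh_pos (π * z.re)
  have h0 : 0 ≤ (1 - ρ) * Real.cosh (π * z.re) := by
    apply mul_nonneg <;> linarith
  rw [sq]
  apply mul_le_mul <;> nlinarith

lemma dd_zero {α : ℝ} (hα : α ∈ Ioo (0:ℝ) 1) {z : ℂ} (hz : z ∈ Strip) (h : dd α z = 0) :
    z = α * I := by
  obtain ⟨ha, hb⟩ := hα
  obtain ⟨hz0, hz1⟩ := hz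
  have hn := dd_normSq α z
  have hpi := Real.pi_pos
  rw [h] at hn
  simp only [norm_zero, ne_eq, OfNat.ofNat_ne_zero, not_false_eq_true, zero_pow] at hn
  have hc := Real.one_le_cosh (π * z.re)
  rcases mul_eq_zero.1 hn.symm with h1 | h1
  · have c1 := Real.cos_le_one (π * (z.im - α))
    have e1 : Real.cosh (π * z.re) = 1 := by linarith
    have e2 : Real.cos (π * (z.im - α)) = 1 := by linarith
    have e3 : π * z.re = 0 := by
      by_contra hne
      have := Real.one_lt_cosh.2 hne
      linarith
    have e4 := (Real.cos_eq_one_iff_of_lt_of_lt (x := π * (z.im - α)) (by nlinarith) (by nlinarith)).1 e2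
    apply Complex.ext
    · simp; simpa [hpi.ne'] using e3
    · simp; have : z.im - α = 0 := by simpa [hpi.ne'] using e4
      linarith
  · have c1 := Real.cos_le_one (π * (z.im + α))
    have e2 : Real.cos (π * (z.im + α)) = 1 := by linarith
    have e5 : Real.cos (π * (z.im + α) - π) = -1 := by rw [Real.cos_sub_pi, e2]
    have e6 : Real.cos (π * (z.im + α) - π) = Real.cos (|π * (z.im + α) - π|) := (Real.cos_abs _).symm
    have e7 : |π * (z.im + α) - π| < π := by rw [abs_lt]; constructor <;> nlinarith
    have e8 := Real.cos_lt_cos_of_nonneg_of_le_pi (abs_nonneg (π * (z.im + α) - π)) le_rfl e7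
    rw [Real.cos_pi] at e8
    linarith

lemma dd_at (α : ℝ) : dd α (α * I) = 0 := by
  simp only [dd]
  rw [← mul_assoc, Complex.cosh_mul_I]; simp

lemma dd_deriv {α : ℝ} (hα : α ∈ Ioo (0:ℝ) 1) : deriv (dd α) (α * I) ≠ 0 := by
  have h : HasDerivAt (dd α) (Complex.sinh (π * (α * I)) * (π * 1)) (α * I) :=
    ((hasDerivAt_id _).const_mul (π:ℂ)).ccosh.sub_const _
  rw [h.deriv, show (π:ℂ) * (α * I) = (π * α) * I by ring, Complex.sinh_mul_I]
  have : Real.sin (π * α) ≠ 0 :=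
    (Real.sin_pos_of_pos_of_lt_pi (mul_pos Real.pi_pos hα.1) (by nlinarith [hα.2, Real.pi_pos])).ne'
  have h2 : Complex.sin (π * α) ≠ 0 := by exact_mod_cast this
  simp [h2, Real.pi_ne_zero]

lemma dd_line0 (α x : ℝ) : dd α x = ((Real.cosh (π * x) - Real.cos (π * α) : ℝ) : ℂ) := by
  simp [dd]

lemma dd_line1 (α x : ℝ) : dd α (x + I) = ((-(Real.cosh (π * x) - Real.cos (π * (1 - α))) : ℝ) : ℂ) := by
  have e : Real.cos (π * (1 - α)) = - Real.cos (π * α) := by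
    rw [mul_sub, mul_one, Real.cos_pi_sub]
  rw [e, dd, mul_add, Complex.cosh_add, Complex.cosh_mul_I, Complex.sinh_mul_I]
  simp
  ring

/-- region where the kernel is controlled -/
def Good (α : ℝ) : Set ℂ := {z | |z.im| ≤ min α (1-α) / 2 ∨ |z.im - 1| ≤ min α (1-α) / 2 ∨ 1 ≤ |z.re|}

lemma dd_good {α : ℝ} (hα : α ∈ Ioo (0:ℝ) 1) : ∃ C, 0 ≤ C ∧ ∀ z ∈ Good α,
    dd α z ≠ 0 ∧ ‖(dd α z)⁻¹‖ ≤ C * Real.exp (-|z.re|) := by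
  obtain ⟨ha, hb⟩ := hα
  have hpi := Real.pi_pos
  have m1 : min α (1-α) ≤ α := min_le_left _ _
  have m2 : min α (1-α) ≤ 1 - α := min_le_right _ _
  have hcos : ∀ {θ β : ℝ}, 0 < β → β ≤ |θ| → |θ| ≤ 1 → Real.cos (π * θ) ≤ Real.cos (π * β) := by
    intro θ β h0 h1 h2
    rw [← Real.cos_abs (π * θ), abs_mul, abs_of_pos hpi]
    apply Real.cos_le_cos_of_nonneg_of_le_pi <;> nlinarith
  have hlt : ∀ {β : ℝ}, 0 < β → β ≤ 1 → Real.cos (π * β) < 1 := by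
    intro β h0 h1
    rw [← Real.cos_zero]
    apply Real.cos_lt_cos_of_nonneg_of_le_pi <;> nlinarith
  set ρ := max (max (Real.cos (π * (α/2))) (Real.cos (π * ((1-α)/2)))) (Real.cosh (π * 1))⁻¹ with hρ
  have hρ1 : ρ < 1 := by
    rw [hρ]
    refine max_lt (max_lt (hlt (by linarith) (by linarith)) (hlt (by linarith) (by linarith))) ?_
    apply inv_lt_one_of_one_lt₀
    exact Real.one_lt_cosh.2 (by simpa using hpi.ne')
  have r1 : Real.cos (π * (α/2)) ≤ ρ := (le_max_left _ _).trans (le_max_left _ _)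
  have r2 : Real.cos (π * ((1-α)/2)) ≤ ρ := (le_max_right _ _).trans (le_max_left _ _)
  have r3 : (Real.cosh (π * 1))⁻¹ ≤ ρ := le_max_right _ _
  have hρ0 : 0 < ρ := lt_of_lt_of_le (inv_pos.2 (Real.cosh_pos _)) r3
  refine ⟨2 / (1 - ρ), div_nonneg (by norm_num) (by linarith), fun z hz => ?_⟩
  have hch := Real.one_le_cosh (π * z.re)
  have hself : ρ ≤ ρ * Real.cosh (π * z.re) := by nlinarith
  have low : (1 - ρ) * Real.cosh (π * z.re) ≤ ‖dd α z‖ := by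
    rcases hz with h | h | h
    · rw [abs_le] at h
      apply dd_lower hρ1.le
      · refine (hcos (θ := z.im - α) (β := α/2) (by linarith) ?_ ?_).trans (r1.trans hself)
        · rw [abs_of_neg (by linarith)]; linarith
        · rw [abs_of_neg (by linarith)]; linarith
      · refine (hcos (θ := z.im + α) (β := α/2) (by linarith) ?_ ?_).trans (r1.trans hself)
        · rw [abs_of_pos (by linarith)]; linarith
        · rw [abs_of_pos (by linarith)]; linarith
    · rw [abs_le] at h
      apply dd_lower hρ1.le
      · refine (hcos (θ := z.im - α) (β := (1-α)/2) (by linarith) ?_ ?_).trans (r2.trans hself)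
        · rw [abs_of_pos (by linarith)]; linarith
        · rw [abs_of_pos (by linarith)]; linarith
      · have e : Real.cos (π * (z.im + α)) = Real.cos (π * (z.im + α - 2)) := by
          rw [← Real.cos_sub_two_pi]; congr 1; ring
        rw [e]
        refine (hcos (θ := z.im + α - 2) (β := (1-α)/2) (by linarith) ?_ ?_).trans (r2.trans hself)
        · rw [abs_of_neg (by linarith)]; linarith
        · rw [abs_of_neg (by linarith)]; linarith
    · have h5 : Real.cosh (π * 1) ≤ Real.cosh (π * z.re) := by
        rw [Real.cosh_le_cosh, abs_mul, abs_mul]; simp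
        nlinarith [abs_of_pos hpi]
      have h6 : 1 ≤ ρ * Real.cosh (π * z.re) := by
        calc (1:ℝ) = (Real.cosh (π * 1))⁻¹ * Real.cosh (π * 1) := by
              rw [inv_mul_cancel₀ (Real.cosh_pos _).ne']
          _ ≤ _ := by
              apply mul_le_mul r3 h5 (Real.cosh_pos _).le hρ0.le
      exact dd_lower hρ1.le ((Real.cos_le_one _).trans h6) ((Real.cos_le_one _).trans h6)
  have hexp : Real.exp |z.re| / 2 ≤ Real.cosh (π * z.re) := by
    rw [← Real.cosh_abs, abs_mul, abs_of_pos hpi, Real.cosh_eq]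
    have : Real.exp |z.re| ≤ Real.exp (π * |z.re|) := by
      apply Real.exp_le_exp.2
      nlinarith [abs_nonneg z.re, Real.pi_gt_three]
    have := Real.exp_pos (-(π * |z.re|))
    linarith
  have low2 : (1 - ρ) * (Real.exp |z.re| / 2) ≤ ‖dd α z‖ :=
    le_trans (by gcongr) low
  have pos : 0 < (1 - ρ) * (Real.exp |z.re| / 2) := mul_pos (by linarith) (by positivity)
  refine ⟨norm_pos_iff.1 (pos.trans_le low2), ?_⟩
  rw [norm_inv]
  refine (inv_anti₀ pos low2).trans (le_of_eq ?_)
  rw [Real.exp_neg, mul_inv, inv_div]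
  ring

lemma integrable_A {α : ℝ} (hα : α ∈ Ioo (0:ℝ) 1) :
    Integrable (fun x : ℝ => (Real.cosh (π * x) - Real.cos (π * α))⁻¹) := by
  obtain ⟨C, hC0, hC⟩ := dd_good hα
  have hc : Continuous (fun x : ℝ => (Real.cosh (π * x) - Real.cos (π * α))⁻¹) :=
    Continuous.inv₀ (by fun_prop) (fun x => (A_pos hα x).ne')
  refine (integrable_wt.const_mul C).mono' hc.aestronglyMeasurable (ae_of_all _ fun x => ?_)
  have := (hC x (Or.inl (by
    simp only [Complex.ofReal_im, abs_zero]; have := lt_min hα.1 (sub_pos.2 hα.2); linarith))).2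
  rw [dd_line0, ← Complex.ofReal_inv, Complex.norm_real] at this
  simpa using this

lemma holder_lint {p p' : ℝ≥0∞} (hpp : p.HolderConjugate p') {f g : ℝ → ℂ}
    (hf : AEStronglyMeasurable f volume) (hg : AEStronglyMeasurable g volume) :
    ∫⁻ x, ‖f x * g x‖ₑ ≤ eLpNorm f p volume * eLpNorm g p' volume := by
  haveI := hpp
  have := eLpNorm_smul_le_mul_eLpNorm (p := p) (q := p') (r := 1) hg hf
  rw [eLpNorm_one_eq_lintegral_enorm] at this
  simpa using this

lemma exists_conj {p : ℝ≥0∞} (hp : 1 ≤ p) : ∃ p' : ℝ≥0∞, 1 ≤ p' ∧ p.HolderConjugate p' ∧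
    (p'⁻¹).toReal = 1 - (p⁻¹).toReal := by
  haveI := ENNReal.HolderConjugate.conjExponent hp
  have h := ENNReal.HolderConjugate.inv_add_inv_eq_one p (ENNReal.conjExponent p)
  refine ⟨ENNReal.conjExponent p, ENNReal.HolderConjugate.one_le _ p, this, ?_⟩
  have h1 : p⁻¹ ≠ ⊤ := by simpa using (zero_lt_one.trans_le hp).ne'
  have h2 : (ENNReal.conjExponent p)⁻¹ ≠ ⊤ := by
    intro hh; rw [hh] at h; simp at h
  have := congrArg ENNReal.toReal h
  rw [ENNReal.toReal_add h1 h2] at this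
  simp only [ENNReal.toReal_one] at this
  linarith

lemma wt_bound {p : ℝ≥0∞} (hp : 1 ≤ p) : ∃ C : ℝ≥0∞, C < ⊤ ∧ ∀ f : ℝ → ℂ, Measurable f →
    ∫⁻ x, ‖f x‖ₑ * ENNReal.ofReal (Real.exp (-|x|)) ≤ C * eLpNorm f p volume := by
  obtain ⟨p', hp', hc, -⟩ := exists_conj hp
  refine ⟨eLpNorm (fun x : ℝ => ((Real.exp (-|x|) : ℝ) : ℂ)) p' volume, ?_, fun f hf => ?_⟩
  · refine lt_of_le_of_lt (eLpNorm_wt_lt_top hp' zero_le_one fun x => ?_) ENNReal.ofReal_lt_top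
    rw [Complex.norm_real, Real.norm_eq_abs, abs_of_pos (Real.exp_pos _), one_mul]
  · rw [mul_comm]
    refine le_trans (le_of_eq ?_) (holder_lint hc hf.aestronglyMeasurable ?_)
    · congr 1; ext x
      rw [enorm_mul, ← ofReal_norm_eq_enorm ((Real.exp (-|x|) : ℝ) : ℂ), Complex.norm_real,
        Real.norm_eq_abs, abs_of_pos (Real.exp_pos _)]
    · exact (by fun_prop : Continuous fun x : ℝ => ((Real.exp (-|x|) : ℝ) : ℂ)).aestronglyMeasurable

lemma hardy_bound {p q : ℝ≥0∞} (hp : 1 ≤ p) (hq : 1 ≤ q) {h : ℂ → ℂ} (hh : MemHardy p q h) :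
    ∃ K : ℝ≥0∞, K < ⊤ ∧ ∀ y ∈ Ioo (0:ℝ) 1,
      ∫⁻ x : ℝ, ‖h (x + y * I)‖ₑ * ENNReal.ofReal (Real.exp (-|x|)) ≤ K := by
  obtain ⟨C1, hC1, h1⟩ := wt_bound hp
  obtain ⟨C2, hC2, h2⟩ := wt_bound hq
  obtain ⟨M, hM1, hM2⟩ := exists_between hh.2
  refine ⟨C1 * M + C2 * M, by simp [ENNReal.mul_lt_top, *], fun y hy => ?_⟩
  have hlt := lt_of_le_of_lt (le_iSup₂ (f := fun y (_ : y ∈ Ioo (0:ℝ) 1) =>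
    ⨅ (f : ℝ → ℂ) (g : ℝ → ℂ) (_ : Measurable f) (_ : Measurable g)
      (_ : f + g = bLine h y),
      ENNReal.ofReal (1 - y)⁻¹ * eLpNorm f p volume +
        ENNReal.ofReal y⁻¹ * eLpNorm g q volume) y hy) hM1
  simp only [iInf_lt_iff] at hlt
  obtain ⟨f, g, hf, hg, hfg, hlt⟩ := hlt
  have e1 : 1 ≤ ENNReal.ofReal (1 - y)⁻¹ := by
    rw [ENNReal.one_le_ofReal]; exact (one_le_inv₀ (by linarith [hy.2])).2 (by linarith [hy.1])
  have e2 : 1 ≤ ENNReal.ofReal y⁻¹ := by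
    rw [ENNReal.one_le_ofReal]; exact (one_le_inv₀ hy.1).2 hy.2.le
  have a1 : eLpNorm f p volume ≤ M :=
    (le_mul_of_one_le_left' e1).trans (le_self_add.trans hlt.le)
  have a2 : eLpNorm g q volume ≤ M :=
    (le_mul_of_one_le_left' e2).trans (le_add_self.trans hlt.le)
  calc ∫⁻ x : ℝ, ‖h (x + y * I)‖ₑ * ENNReal.ofReal (Real.exp (-|x|))
      ≤ ∫⁻ x : ℝ, (‖f x‖ₑ * ENNReal.ofReal (Real.exp (-|x|)) +
          ‖g x‖ₑ * ENNReal.ofReal (Real.exp (-|x|))) := by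
        apply lintegral_mono
        intro x
        have : h (x + y * I) = f x + g x := (congrFun hfg x).symm
        simp only
        rw [this, ← add_mul]
        gcongr
        exact enorm_add_le _ _
    _ = _ := lintegral_add_left (by fun_prop) _
    _ ≤ C1 * M + C2 * M := by
        gcongr
        · exact (h1 f hf).trans (by gcongr)
        · exact (h2 g hg).trans (by gcongr)

lemma line_cont {h : ℂ → ℂ} (hh : DifferentiableOn ℂ h Strip) {y : ℝ} (hy : y ∈ Ioo (0:ℝ) 1) :
    Continuous (fun x : ℝ => h (x + y * I)) := by
  rw [← continuousOn_univ]
  refine hh.continuousOn.comp (by fun_prop) fun x _ => ?_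
  simp only [Strip, mem_setOf_eq, add_im, ofReal_im, mul_im, I_re, I_im, ofReal_re]
  constructor <;> simp [hy.1, hy.2]

lemma mem_strip_iff (x y : ℝ) : ((x:ℂ) + y * I) ∈ Strip ↔ y ∈ Ioo (0:ℝ) 1 := by
  simp [Strip]

lemma isOpen_Strip : IsOpen Strip :=
  (isOpen_lt continuous_const Complex.continuous_im).inter
    (isOpen_lt Complex.continuous_im continuous_const)

lemma line_integrable {T : ℂ → ℂ} (hT : DifferentiableOn ℂ T Strip) {R0 : ℝ} {K : ℝ≥0∞}
    (hK : K < ⊤) {y : ℝ} (hy : y ∈ Ioo (0:ℝ) 1)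
    (hb : ∫⁻ x : ℝ in {x | R0 ≤ |x|}, ‖T (x + y * I)‖ₑ ≤ K) :
    Integrable (fun x : ℝ => T (x + y * I)) := by
  have hc := line_cont hT hy
  rw [← integrableOn_univ]
  have : (univ : Set ℝ) = Icc (-R0) R0 ∪ {x | R0 ≤ |x|} := by
    ext x
    simp only [mem_univ, mem_union, mem_Icc, mem_setOf_eq, true_iff]
    rw [← abs_le]; exact le_total _ _
  rw [this]
  refine IntegrableOn.union hc.continuousOn.integrableOn_Icc ⟨hc.aestronglyMeasurable, ?_⟩
  exact lt_of_le_of_lt hb hK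

lemma small_sides {τ : ℂ → ℂ} (hτ : Measurable τ) {R0 : ℝ} {K : ℝ≥0∞}
    (hK : K < ⊤) (hb : ∀ y ∈ Ioo (0:ℝ) 1, ∫⁻ x : ℝ in {x | R0 ≤ |x|}, ‖τ (x + y * I)‖ₑ ≤ K)
    {y0 y1 : ℝ} (h0 : y0 ∈ Ioo (0:ℝ) 1) (h1 : y1 ∈ Ioo (0:ℝ) 1) {ε : ℝ≥0∞} (hε : 0 < ε) (hε' : ε < ⊤)
    (N : ℝ) :
    ∃ R, N ≤ R ∧ ∫⁻ y in Ioc y0 y1, ‖τ ((R:ℝ) + (y:ℝ) * I)‖ₑ ≤ ε ∧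
      ∫⁻ y in Ioc y0 y1, ‖τ (((-R:ℝ):ℂ) + (y:ℝ) * I)‖ₑ ≤ ε := by
  set V : ℝ → ℝ≥0∞ := fun x => ∫⁻ y in Ioc y0 y1, ‖τ ((x:ℝ) + (y:ℝ) * I)‖ₑ with hV
  have hm : Measurable (fun z : ℝ × ℝ => ‖τ ((z.1:ℝ) + (z.2:ℝ) * I)‖ₑ) := by
    apply Measurable.enorm
    apply hτ.comp
    fun_prop
  have hVm : Measurable V := hm.lintegral_prod_right'
  have hA : ∫⁻ x in {x : ℝ | R0 ≤ |x|}, V x < ⊤ := by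
    rw [lintegral_lintegral_swap hm.aemeasurable]
    calc _ ≤ ∫⁻ y in Ioc y0 y1, K := by
          apply setLIntegral_mono measurable_const
          intro y hy
          exact hb y ⟨h0.1.trans hy.1, hy.2.trans_lt h1.2⟩
      _ < ⊤ := by
          rw [setLIntegral_const]
          exact ENNReal.mul_lt_top hK (by simp)
  by_contra hcon
  push Not at hcon
  have hAs : MeasurableSet {x : ℝ | R0 ≤ |x|} := measurableSet_le measurable_const (by fun_prop)
  have mk := mul_meas_ge_le_lintegral₀ (μ := volume.restrict {x : ℝ | R0 ≤ |x|}) hVm.aemeasurable ε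
  have fin : volume ({x | ε ≤ V x} ∩ {x : ℝ | R0 ≤ |x|}) < ⊤ := by
    rw [Measure.restrict_apply (measurableSet_le measurable_const hVm)] at mk
    by_contra hh
    rw [not_lt, top_le_iff] at hh
    rw [hh, ENNReal.mul_top hε.ne'] at mk
    exact absurd hA (not_lt.2 mk)
  set B := {x | ε ≤ V x} ∩ {x : ℝ | R0 ≤ |x|} with hB
  have sub : Ici (max N R0) ⊆ B ∪ (Neg.neg ⁻¹' B) := by
    intro x hx
    rw [mem_Ici, max_le_iff] at hx
    have hx2 : R0 ≤ |x| := hx.2.trans (le_abs_self x)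
    by_cases hc : V x ≤ ε
    · right
      refine ⟨(hcon x hx.1 hc).le, ?_⟩
      simpa using hx2
    · left; exact ⟨(not_le.1 hc).le, hx2⟩
  have : volume (Ici (max N R0)) ≤ volume B + volume B := by
    refine (measure_mono sub).trans ((measure_union_le _ _).trans ?_)
    rw [Measure.measure_preimage_neg]
  rw [Real.volume_Ici, top_le_iff] at this
  exact absurd this (ENNReal.add_lt_top.2 ⟨fin, fin⟩).ne

lemma shift_integral {T : ℂ → ℂ} (hT : DifferentiableOn ℂ T Strip) {R0 : ℝ} {K : ℝ≥0∞}
    (hK : K < ⊤) (hb : ∀ y ∈ Ioo (0:ℝ) 1, ∫⁻ x : ℝ in {x | R0 ≤ |x|}, ‖T (x + y * I)‖ₑ ≤ K)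
    {y0 y1 : ℝ} (h0 : y0 ∈ Ioo (0:ℝ) 1) (h1 : y1 ∈ Ioo (0:ℝ) 1) (h01 : y0 ≤ y1) :
    ∫ x : ℝ, T (x + y0 * I) = ∫ x : ℝ, T (x + y1 * I) := by
  classical
  set τ : ℂ → ℂ := Strip.piecewise T 0 with hτd
  have hτ : Measurable τ := ContinuousOn.measurable_piecewise hT.continuousOn continuousOn_const
    isOpen_Strip.measurableSet
  have eqτ : ∀ x y : ℝ, y ∈ Ioo (0:ℝ) 1 → τ (x + y * I) = T (x + y * I) := fun x y hy =>
    Set.piecewise_eq_of_mem _ _ _ ((mem_strip_iff x y).2 hy)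
  have hb' : ∀ y ∈ Ioo (0:ℝ) 1, ∫⁻ x : ℝ in {x | R0 ≤ |x|}, ‖τ (x + y * I)‖ₑ ≤ K := by
    intro y hy
    simp only [eqτ _ y hy]; exact hb y hy
  have lim : ∀ y ∈ Ioo (0:ℝ) 1, Tendsto (fun R : ℝ => ∫ x in (-R)..R, T (x + y * I)) atTop
      (𝓝 (∫ x : ℝ, T (x + y * I))) := fun y hy =>
    intervalIntegral_tendsto_integral (line_integrable hT hK hy (hb y hy))
      tendsto_neg_atTop_atBot tendsto_id
  by_contra hne
  have hD : 0 < ‖(∫ x : ℝ, T (x + y0 * I)) - ∫ x : ℝ, T (x + y1 * I)‖ :=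
    norm_pos_iff.2 (sub_ne_zero.2 hne)
  set D := ‖(∫ x : ℝ, T (x + y0 * I)) - ∫ x : ℝ, T (x + y1 * I)‖
  have lim2 := ((lim y0 h0).sub (lim y1 h1)).norm
  have ev := lim2.eventually (lt_mem_nhds (half_lt_self hD))
  obtain ⟨N, hN⟩ := eventually_atTop.1 ev
  obtain ⟨R, hR, s1, s2⟩ := small_sides hτ hK hb' h0 h1 (ε := ENNReal.ofReal (D/4)) (by simpa using hD)
    ENNReal.ofReal_lt_top N
  have hRD := hN R hR
  have side : ∀ r : ℝ, ∫⁻ y in Ioc y0 y1, ‖τ ((r:ℝ) + (y:ℝ) * I)‖ₑ ≤ ENNReal.ofReal (D/4) →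
      ‖∫ y in y0..y1, T (r + y * I)‖ ≤ D / 4 := by
    intro r hr
    rw [intervalIntegral.integral_of_le h01]
    have e : ∫ y in Ioc y0 y1, T (r + y * I) = ∫ y in Ioc y0 y1, τ (r + y * I) := by
      apply setIntegral_congr_fun measurableSet_Ioc
      intro y hy
      exact (eqτ r y ⟨h0.1.trans hy.1, hy.2.trans_lt h1.2⟩).symm
    rw [e]
    have h3 := (enorm_integral_le_lintegral_enorm _).trans hr
    rw [← ofReal_norm_eq_enorm] at h3
    exact (ENNReal.ofReal_le_ofReal_iff (by positivity)).1 h3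
  have rect := Complex.integral_boundary_rect_eq_zero_of_differentiableOn T
    (((-R:ℝ):ℂ) + y0 * I) ((R:ℂ) + y1 * I) (hT.mono ?_)
  · simp only [add_re, ofReal_re, mul_re, ofReal_im, I_re, I_im, mul_zero, mul_one, sub_zero, add_zero,
      add_im, mul_im, zero_add, zero_mul] at rect
    have b1 := side R s1
    have b2 := side (-R) s2
    have e : (∫ x in (-R)..R, T (x + y0 * I)) - (∫ x in (-R)..R, T (x + y1 * I)) =
      I • (∫ y in y0..y1, T (((-R:ℝ):ℂ) + y * I)) - I • (∫ y in y0..y1, T (R + y * I)) := by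
      linear_combination rect
    rw [e] at hRD
    have : ‖I • (∫ y in y0..y1, T (((-R:ℝ):ℂ) + y * I)) - I • (∫ y in y0..y1, T (R + y * I))‖ ≤ D/4 + D/4 := by
      refine (norm_sub_le _ _).trans ?_
      rw [norm_smul, norm_smul, Complex.norm_I, one_mul, one_mul]
      exact add_le_add b2 b1
    linarith
  · intro z hz
    rw [mem_reProdIm] at hz
    have := hz.2
    simp only [add_im, ofReal_im, mul_im, ofReal_re, I_im, I_re, mul_zero, mul_one, zero_add, add_zero] at this
    rw [uIcc_of_le h01] at this
    exact ⟨h0.1.trans_le this.1, this.2.trans_lt h1.2⟩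

/-- thin horizontal strip -/
def Thin (y δ : ℝ) : Set ℂ := {z : ℂ | |z.im - y| < δ}

lemma isOpen_Thin (y δ : ℝ) : IsOpen (Thin y δ) :=
  isOpen_lt (by fun_prop) continuous_const

lemma thin_deriv {y δ C : ℝ} (hδ : 0 < δ) (hC : 0 ≤ C) {k : ℂ → ℂ}
    (hk : DifferentiableOn ℂ k (Thin y δ))
    (hb : ∀ z ∈ Thin y δ, ‖k z‖ ≤ C * Real.exp (-|z.re|)) :
    ∀ z ∈ Thin y (δ/2), ‖deriv k z‖ ≤ (C * Real.exp (δ/2) / (δ/2)) * Real.exp (-|z.re|) := by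
  intro z hz
  have hsub : Metric.closedBall z (δ/2) ⊆ Thin y δ := by
    intro w hw
    rw [Metric.mem_closedBall, dist_eq_norm] at hw
    have h1 := (Complex.abs_im_le_norm (w - z)).trans hw
    have hz' : |z.im - y| < δ/2 := hz
    rw [sub_im] at h1
    show |w.im - y| < δ
    calc |w.im - y| = |(w.im - z.im) + (z.im - y)| := by ring_nf
      _ ≤ |w.im - z.im| + |z.im - y| := abs_add_le _ _
      _ < δ := by linarith
  have hd : DiffContOnCl ℂ k (Metric.ball z (δ/2)) := by
    apply DifferentiableOn.diffContOnCl
    rw [closure_ball z (by positivity)]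
    exact hk.mono hsub
  have := Complex.norm_deriv_le_of_forall_mem_sphere_norm_le (c := z) (R := δ/2)
    (C := C * Real.exp (δ/2) * Real.exp (-|z.re|)) (by positivity) hd ?_
  · refine this.trans (le_of_eq ?_); ring
  · intro w hw
    have hw' := Metric.sphere_subset_closedBall hw
    refine (hb w (hsub hw')).trans ?_
    rw [mul_assoc, ← Real.exp_add]
    gcongr
    rw [Metric.mem_closedBall, dist_eq_norm] at hw'
    have h1 := (Complex.abs_re_le_norm (w - z)).trans hw'
    rw [sub_re] at h1
    have h2 : |z.re| ≤ |w.re| + |w.re - z.re| := by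
      calc |z.re| = |w.re - (w.re - z.re)| := by ring_nf
        _ ≤ _ := abs_sub _ _
    linarith

lemma thin_iter {y : ℝ} (n : ℕ) : ∀ {δ C : ℝ} (_ : 0 < δ) (_ : 0 ≤ C) {k : ℂ → ℂ}
    (_ : DifferentiableOn ℂ k (Thin y δ))
    (_ : ∀ z ∈ Thin y δ, ‖k z‖ ≤ C * Real.exp (-|z.re|)),
    ∃ C', ∀ x : ℝ, ‖iteratedDeriv n (fun x : ℝ => k (x + y * I)) x‖ ≤ C' * Real.exp (-|x|) := by
  induction n with
  | zero =>
    intro δ C hδ hC k hk hb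
    refine ⟨C, fun x => ?_⟩
    have := hb (x + y * I) (by simpa [Thin] using hδ)
    simpa using this
  | succ n ih =>
    intro δ C hδ hC k hk hb
    have hsub : Thin y (δ/2) ⊆ Thin y δ := fun z hz => lt_trans hz (half_lt_self hδ)
    obtain ⟨C', h'⟩ := ih (half_pos hδ) (by positivity : 0 ≤ C * Real.exp (δ/2) / (δ/2))
      ((hk.deriv (isOpen_Thin y δ)).mono hsub) (thin_deriv hδ hC hk hb)
    refine ⟨C', fun x => ?_⟩
    have e : deriv (fun x : ℝ => k (x + y * I)) = fun x : ℝ => deriv k (x + y * I) := by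
      ext x
      have hd : HasDerivAt k (deriv k (x + y * I)) (x + y * I) :=
        (hk.differentiableAt ((isOpen_Thin y δ).mem_nhds (by simpa [Thin] using hδ))).hasDerivAt
      have h2 : HasDerivAt (fun x : ℝ => (x:ℂ) + y * I) 1 x :=
        (Complex.ofRealCLM.hasDerivAt (x := x)).add_const _
      have := hd.comp x h2
      rw [mul_one] at this
      exact this.deriv
    rw [iteratedDeriv_succ', e]
    exact h' x

lemma thin_schwartz {y δ C : ℝ} (hδ : 0 < δ) (hC : 0 ≤ C) {k : ℂ → ℂ}
    (hk : DifferentiableOn ℂ k (Thin y δ))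
    (hb : ∀ z ∈ Thin y δ, ‖k z‖ ≤ C * Real.exp (-|z.re|)) :
    ∃ φ : SchwartzMap ℝ ℂ, ∀ x : ℝ, (starRingEnd ℂ) (φ x) = k (x + y * I) := by
  have sm : ContDiff ℝ (⊤ : ℕ∞) (fun x : ℝ => k (x + y * I)) := by
    have h1 : ContDiffOn ℝ (⊤ : ℕ∞) k (Thin y δ) :=
      (hk.contDiffOn (isOpen_Thin y δ)).restrict_scalars ℝ
    have h2 : ContDiff ℝ (⊤ : ℕ∞) (fun x : ℝ => (x:ℂ) + y * I) :=
      Complex.ofRealCLM.contDiff.add contDiff_const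
    exact h1.comp_contDiff h2 (fun x => by simpa [Thin] using hδ)
  refine ⟨⟨fun x => (starRingEnd ℂ) (k (x + y * I)), ?_, ?_⟩, fun x => ?_⟩
  · exact Complex.conjLIE.contDiff.comp sm
  · intro m n
    obtain ⟨C', h'⟩ := thin_iter n hδ hC hk hb
    refine ⟨m.factorial * C', fun x => ?_⟩
    have e := Complex.conjLIE.norm_iteratedFDeriv_comp_left (fun x : ℝ => k (x + y * I)) x n
    have e2 : (fun x : ℝ => (starRingEnd ℂ) (k (x + y * I))) =
      Complex.conjLIE ∘ (fun x : ℝ => k (x + y * I)) := rfl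
    rw [e2, e, norm_iteratedFDeriv_eq_norm_iteratedDeriv]
    have hC' : 0 ≤ C' := by
      have := (norm_nonneg _).trans (h' 0)
      exact nonneg_of_mul_nonneg_left this (Real.exp_pos _)
    have hp : |x| ^ m ≤ m.factorial * Real.exp |x| := by
      have := Real.pow_div_factorial_le_exp |x| (abs_nonneg x) m
      rw [div_le_iff₀ (by positivity)] at this
      linarith
    calc ‖x‖ ^ m * ‖iteratedDeriv n (fun x : ℝ => k (x + y * I)) x‖
        ≤ (m.factorial * Real.exp |x|) * (C' * Real.exp (-|x|)) := by
          rw [Real.norm_eq_abs]; gcongr; exact h' x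
      _ = m.factorial * C' * (Real.exp |x| * Real.exp (-|x|)) := by ring
      _ = _ := by rw [← Real.exp_add]; simp
  · show (starRingEnd ℂ) ((starRingEnd ℂ) (k (x + y * I))) = _
    simp

lemma thin_lip {y δ C : ℝ} (hδ : 0 < δ) (hC : 0 ≤ C) {k : ℂ → ℂ}
    (hk : DifferentiableOn ℂ k (Thin y δ))
    (hb : ∀ z ∈ Thin y δ, ‖k z‖ ≤ C * Real.exp (-|z.re|)) {η : ℝ} (hη : |η - y| < δ/2) (x : ℝ) :
    ‖k (x + η * I) - k (x + y * I)‖ ≤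
      (C * Real.exp (δ/2) / (δ/2)) * Real.exp (-|x|) * |η - y| := by
  have hs : Convex ℝ {z : ℂ | z.re = x ∧ |z.im - y| < δ/2} := by
    have e : {z : ℂ | z.re = x ∧ |z.im - y| < δ/2} = Complex.reLm ⁻¹' {x} ∩
      Complex.imLm ⁻¹' (Ioo (y - δ/2) (y + δ/2)) := by
      ext z
      simp only [mem_setOf_eq, mem_inter_iff, mem_preimage, Complex.reLm_coe, Complex.imLm_coe, mem_singleton_iff,
        mem_Ioo, abs_lt]
      constructor <;> rintro ⟨h, h2, h3⟩ <;> refine ⟨h, ?_, ?_⟩ <;> linarith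
    rw [e]
    exact ((convex_singleton x).linear_preimage _).inter ((convex_Ioo _ _).linear_preimage _)
  have := Convex.norm_image_sub_le_of_norm_deriv_le (𝕜 := ℂ) (f := k) (s := {z : ℂ | z.re = x ∧ |z.im - y| < δ/2})
    (x := x + y * I) (y := x + η * I)
    (C := (C * Real.exp (δ/2) / (δ/2)) * Real.exp (-|x|)) ?_ ?_ hs ?_ ?_
  · refine this.trans (le_of_eq ?_)
    congr 1
    have : (x:ℂ) + η * I - (x + y * I) = ((η - y : ℝ) : ℂ) * I := by push_cast; ring
    rw [this, norm_mul, Complex.norm_I, mul_one, Complex.norm_real, Real.norm_eq_abs]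
  · rintro z ⟨-, hz⟩
    exact hk.differentiableAt ((isOpen_Thin y δ).mem_nhds (lt_trans hz (half_lt_self hδ)))
  · rintro z ⟨hz1, hz⟩
    have := thin_deriv hδ hC hk hb z hz
    rwa [hz1] at this
  · simpa using hδ
  · simpa using hη

lemma wt_mul_integrable {h : ℂ → ℂ} (hh : DifferentiableOn ℂ h Strip) {K : ℝ≥0∞} (hK : K < ⊤)
    {η : ℝ} (hη : η ∈ Ioo (0:ℝ) 1)
    (hB : ∫⁻ x : ℝ, ‖h (x + η * I)‖ₑ * ENNReal.ofReal (Real.exp (-|x|)) ≤ K)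
    {g : ℝ → ℂ} (hg : AEStronglyMeasurable g volume) {B : ℝ} (hB0 : 0 ≤ B)
    (hgb : ∀ x, ‖g x‖ ≤ B * Real.exp (-|x|)) :
    Integrable (fun x : ℝ => h (x + η * I) * g x) ∧
      ‖∫ x : ℝ, h (x + η * I) * g x‖ ≤ B * K.toReal := by
  have le : ∫⁻ x : ℝ, ‖h (x + η * I) * g x‖ₑ ≤ ENNReal.ofReal B * K := by
    refine le_trans ?_ (mul_le_mul_right hB _)
    rw [← lintegral_const_mul' _ _ ENNReal.ofReal_ne_top]
    apply lintegral_mono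
    intro x
    simp only
    rw [enorm_mul, mul_left_comm, ← ENNReal.ofReal_mul hB0, ← ofReal_norm_eq_enorm (g x)]
    gcongr
    exact hgb x
  refine ⟨⟨(line_cont hh hη).aestronglyMeasurable.mul hg, ?_⟩, ?_⟩
  · exact le.trans_lt (ENNReal.mul_lt_top ENNReal.ofReal_lt_top hK)
  · have h3 := (enorm_integral_le_lintegral_enorm _).trans le
    have h4 := ENNReal.toReal_mono (ENNReal.mul_lt_top ENNReal.ofReal_lt_top hK).ne h3
    rwa [ENNReal.toReal_mul, ENNReal.toReal_ofReal hB0, toReal_enorm] at h4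

lemma thin_lim {y δ C : ℝ} (hδ : 0 < δ) (hC : 0 ≤ C) {k : ℂ → ℂ}
    (hk : DifferentiableOn ℂ k (Thin y δ))
    (hb : ∀ z ∈ Thin y δ, ‖k z‖ ≤ C * Real.exp (-|z.re|))
    {h : ℂ → ℂ} (hh : DifferentiableOn ℂ h Strip) {K : ℝ≥0∞} (hK : K < ⊤)
    (hB : ∀ η ∈ Ioo (0:ℝ) 1, ∫⁻ x : ℝ, ‖h (x + η * I)‖ₑ * ENNReal.ofReal (Real.exp (-|x|)) ≤ K)
    {l : Filter ℝ} (hl : l ≤ 𝓝 y) (hl2 : ∀ᶠ η in l, η ∈ Ioo (0:ℝ) 1) {v : ℝ → ℂ}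
    (hv : ∀ φ : SchwartzMap ℝ ℂ,
      Tendsto (fun y : ℝ => ∫ x : ℝ, h (x + y * Complex.I) * (starRingEnd ℂ) (φ x))
      l (𝓝 (∫ x : ℝ, v x * (starRingEnd ℂ) (φ x)))) :
    Tendsto (fun η : ℝ => ∫ x : ℝ, h (x + η * I) * k (x + η * I)) l
      (𝓝 (∫ x : ℝ, v x * k (x + y * I))) := by
  obtain ⟨φ, hφ⟩ := thin_schwartz hδ hC hk hb
  have t1 := hv φ
  simp only [hφ] at t1
  set L := C * Real.exp (δ/2) / (δ/2) with hL
  have hL0 : 0 ≤ L := by positivity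
  have hcont : ∀ η, |η - y| < δ → Continuous (fun x : ℝ => k (x + η * I)) := by
    intro η hη
    rw [← continuousOn_univ]
    refine hk.continuousOn.comp (by fun_prop) fun x _ => ?_
    simpa [Thin] using hη
  have t2 : Tendsto (fun η : ℝ => ∫ x : ℝ, h (x + η * I) * (k (x + η * I) - k (x + y * I))) l (𝓝 0) := by
    have tz : Tendsto (fun η : ℝ => L * |η - y| * K.toReal) l (𝓝 0) := by
      have : Tendsto (fun η : ℝ => L * |η - y| * K.toReal) (𝓝 y) (𝓝 (L * |y - y| * K.toReal)) := by
        apply Continuous.tendsto; fun_prop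
      simp at this
      exact this.mono_left hl
    apply squeeze_zero_norm' _ tz
    filter_upwards [hl2, hl (Metric.ball_mem_nhds y (half_pos hδ))] with η h1 h2
    rw [Metric.mem_ball, Real.dist_eq] at h2
    refine (wt_mul_integrable hh hK h1 (hB η h1) ?_ (B := L * |η - y|) (by positivity) ?_).2
    · exact ((hcont η (by linarith)).sub (hcont y (by simpa using hδ))).aestronglyMeasurable
    · intro x
      refine (thin_lip hδ hC hk hb h2 x).trans (le_of_eq ?_)
      rw [hL]; ring
  have t3 := t1.add t2
  rw [add_zero] at t3
  refine t3.congr' ?_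
  filter_upwards [hl2, hl (Metric.ball_mem_nhds y (half_pos hδ))] with η h1 h2
  rw [Metric.mem_ball, Real.dist_eq] at h2
  rw [← integral_add]
  · congr 1; ext x; ring
  · refine (wt_mul_integrable hh hK h1 (hB η h1) (hcont y (by simpa using hδ)).aestronglyMeasurable hC ?_).1
    intro x
    simpa using hb (x + y * I) (by simpa [Thin] using hδ)
  · refine (wt_mul_integrable hh hK h1 (hB η h1) ?_ (B := L * |η - y|) (by positivity) ?_).1
    · exact ((hcont η (by linarith)).sub (hcont y (by simpa using hδ))).aestronglyMeasurable
    · intro x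
      refine (thin_lip hδ hC hk hb h2 x).trans (le_of_eq ?_)
      rw [hL]; ring

lemma lint_wt_lt_top : ∫⁻ x : ℝ, ENNReal.ofReal (Real.exp (-|x|)) < ⊤ := by
  have := integrable_wt.2
  rw [hasFiniteIntegral_iff_ofReal (ae_of_all _ fun x => (Real.exp_pos _).le)] at this
  exact this

lemma core_id {α : ℝ} (hα : α ∈ Ioo (0:ℝ) 1) {h : ℂ → ℂ} (hh : DifferentiableOn ℂ h Strip)
    {K : ℝ≥0∞} (hK : K < ⊤)
    (hB : ∀ η ∈ Ioo (0:ℝ) 1, ∫⁻ x : ℝ, ‖h (x + η * I)‖ₑ * ENNReal.ofReal (Real.exp (-|x|)) ≤ K)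
    {v0 v1 : ℝ → ℂ} (hv0 : IsTrace0 h v0) (hv1 : IsTrace1 h v1) {n : ℂ → ℂ}
    (hn : DifferentiableOn ℂ n (Dst (min α (1-α) / 2))) {M : ℝ} (hM : 0 ≤ M)
    (hnM : ∀ z ∈ Dst (min α (1-α) / 2), ‖n z‖ ≤ M) :
    h (α * I) * n (α * I) * (((∫ x : ℝ, (Real.cosh (π * x) - Real.cos (π * α))⁻¹) +
      (∫ x : ℝ, (Real.cosh (π * x) - Real.cos (π * (1 - α)))⁻¹) : ℝ) : ℂ) =
    (∫ x : ℝ, v0 x * (n x * (dd α x)⁻¹)) - ∫ x : ℝ, v1 x * (n (x + I) * (dd α (x + I))⁻¹) := by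
  obtain ⟨C, hC0, hC⟩ := dd_good hα
  set δ := min α (1-α) / 2 with hδd
  have hδ : 0 < δ := by have := lt_min hα.1 (sub_pos.2 hα.2); rw [hδd]; linarith
  have hδ1 : δ < 1 := by have := min_le_left α (1-α); have := hα.2; have := hα.1; rw [hδd]; linarith
  set z0 : ℂ := α * I with hz0
  have hz0S : z0 ∈ Strip := by
    have := (mem_strip_iff 0 α).2 hα
    simpa using this
  have hSn : Strip ∈ 𝓝 z0 := isOpen_Strip.mem_nhds hz0S
  have hSD : Strip ⊆ Dst δ := fun z hz => ⟨by linarith [hz.1], by linarith [hz.2]⟩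
  set F : ℂ → ℂ := fun z => h z * n z with hF
  have hFd : DifferentiableOn ℂ F Strip := hh.mul (hn.mono hSD)
  set T : ℂ → ℂ := fun z => dslope F z0 z / dslope (dd α) z0 z with hTd
  have hT : DifferentiableOn ℂ T Strip := by
    apply DifferentiableOn.div
    · exact (Complex.differentiableOn_dslope hSn).2 hFd
    · exact (Complex.differentiableOn_dslope hSn).2 (dd_diff α).differentiableOn
    · intro z hz
      by_cases e : z = z0
      · rw [e, dslope_same]; exact dd_deriv hα
      · rw [dslope_of_ne _ e, slope_def_field, dd_at, sub_zero]
        exact div_ne_zero (fun hzz => e (dd_zero hα hz hzz)) (sub_ne_zero.2 e)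
  have hTe : ∀ z, z ≠ z0 → T z = (F z - F z0) * (dd α z)⁻¹ := by
    intro z e
    have e' : z - z0 ≠ 0 := sub_ne_zero.2 e
    rw [hTd]
    simp only
    rw [dslope_of_ne _ e, dslope_of_ne _ e, slope_def_field, slope_def_field, dd_at, sub_zero,
      div_div_div_cancel_right₀ e', div_eq_mul_inv]
  have hGne : ∀ z ∈ Good α, z ≠ z0 := by
    rintro z hz rfl
    exact (hC _ hz).1 (dd_at α)
  set K1 := ∫⁻ x : ℝ, ENNReal.ofReal (Real.exp (-|x|)) with hK1
  have hK1t : K1 < ⊤ := lint_wt_lt_top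
  -- bound away from the pole
  have hbT : ∀ y ∈ Ioo (0:ℝ) 1, ∫⁻ x : ℝ in {x | (1:ℝ) ≤ |x|}, ‖T (x + y * I)‖ₑ ≤
      ENNReal.ofReal (M * C) * K + ENNReal.ofReal (‖F z0‖ * C) * K1 := by
    intro y hy
    calc ∫⁻ x : ℝ in {x | (1:ℝ) ≤ |x|}, ‖T (x + y * I)‖ₑ
        ≤ ∫⁻ x : ℝ in {x | (1:ℝ) ≤ |x|}, (ENNReal.ofReal (M * C) * (‖h (x + y * I)‖ₑ * ENNReal.ofReal (Real.exp (-|x|)))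
          + ENNReal.ofReal (‖F z0‖ * C) * ENNReal.ofReal (Real.exp (-|x|))) := by
          apply setLIntegral_mono'
          · exact measurableSet_le measurable_const (by fun_prop)
          · intro x hx
            have hg : (x:ℂ) + y * I ∈ Good α := Or.inr (Or.inr (by simpa using hx))
            rw [hTe _ (hGne _ hg)]
            have b1 := (hC _ hg).2
            have b2 := hnM (x + y * I) (hSD ((mem_strip_iff x y).2 hy))
            simp only [add_re, ofReal_re, mul_re, ofReal_im, I_re, I_im, mul_zero, mul_one, sub_zero, add_zero] at b1
            rw [← ofReal_norm_eq_enorm, ← ofReal_norm_eq_enorm, ← ENNReal.ofReal_mul (norm_nonneg _),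
              ← ENNReal.ofReal_mul (by positivity), ← ENNReal.ofReal_mul (by positivity),
              ← ENNReal.ofReal_add (by positivity) (by positivity)]
            apply ENNReal.ofReal_le_ofReal
            rw [norm_mul]
            calc ‖F (x + y * I) - F z0‖ * ‖(dd α (x + y * I))⁻¹‖
                ≤ (‖h (x + y * I)‖ * M + ‖F z0‖) * (C * Real.exp (-|x|)) := by
                  gcongr
                  refine (norm_sub_le _ _).trans ?_
                  gcongr
                  rw [hF]; simp only; rw [norm_mul]; gcongr
              _ = _ := by ring
      _ ≤ ∫⁻ x : ℝ, (ENNReal.ofReal (M * C) * (‖h (x + y * I)‖ₑ * ENNReal.ofReal (Real.exp (-|x|)))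
          + ENNReal.ofReal (‖F z0‖ * C) * ENNReal.ofReal (Real.exp (-|x|))) := setLIntegral_le_lintegral _ _
      _ ≤ _ := by
          rw [lintegral_add_right _ (by fun_prop), lintegral_const_mul' _ _ ENNReal.ofReal_ne_top,
            lintegral_const_mul' _ _ ENNReal.ofReal_ne_top]
          gcongr
          exact hB y hy
  have hKK : ENNReal.ofReal (M * C) * K + ENNReal.ofReal (‖F z0‖ * C) * K1 < ⊤ :=
    ENNReal.add_lt_top.2 ⟨ENNReal.mul_lt_top ENNReal.ofReal_lt_top hK,
      ENNReal.mul_lt_top ENNReal.ofReal_lt_top hK1t⟩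
  have hhalf : (1/2 : ℝ) ∈ Ioo (0:ℝ) 1 := by constructor <;> norm_num
  have const : ∀ y ∈ Ioo (0:ℝ) 1, ∫ x : ℝ, T (x + y * I) = ∫ x : ℝ, T (x + (1/2:ℝ) * I) := by
    intro y hy
    rcases le_total y (1/2) with h' | h'
    · exact shift_integral hT hKK hbT hy hhalf h'
    · exact (shift_integral hT hKK hbT hhalf hy h').symm
  have key : ∀ (y : ℝ) (l : Filter ℝ) [l.NeBot] (v : ℝ → ℂ), Thin y δ ⊆ Good α → Thin y δ ⊆ Dst δ → l ≤ 𝓝 y →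
      (∀ᶠ η in l, η ∈ Ioo (0:ℝ) 1) → (∀ φ : SchwartzMap ℝ ℂ,
      Tendsto (fun y : ℝ => ∫ x : ℝ, h (x + y * Complex.I) * (starRingEnd ℂ) (φ x))
      l (𝓝 (∫ x : ℝ, v x * (starRingEnd ℂ) (φ x)))) →
      ∫ x : ℝ, T (x + (1/2:ℝ) * I) = (∫ x : ℝ, v x * (n (x + y * I) * (dd α (x + y * I))⁻¹)) -
        F z0 * ∫ x : ℝ, (dd α (x + y * I))⁻¹ := by
    intro y l _ v hG hD hl hl2 hv
    have hκd : DifferentiableOn ℂ (fun z => (dd α z)⁻¹) (Thin y δ) :=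
      (dd_diff α).differentiableOn.inv fun z hz => (hC z (hG hz)).1
    have hkd : DifferentiableOn ℂ (fun z => n z * (dd α z)⁻¹) (Thin y δ) := (hn.mono hD).mul hκd
    have hκb : ∀ z ∈ Thin y δ, ‖(dd α z)⁻¹‖ ≤ C * Real.exp (-|z.re|) := fun z hz => (hC z (hG hz)).2
    have hkb : ∀ z ∈ Thin y δ, ‖n z * (dd α z)⁻¹‖ ≤ (M * C) * Real.exp (-|z.re|) := by
      intro z hz
      rw [norm_mul, mul_assoc]
      exact mul_le_mul (hnM z (hD hz)) (hκb z hz) (norm_nonneg _) hM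
    have hB1 : ∀ η ∈ Ioo (0:ℝ) 1, ∫⁻ x : ℝ, ‖(fun _ : ℂ => (1:ℂ)) (x + η * I)‖ₑ * ENNReal.ofReal (Real.exp (-|x|)) ≤ K1 := by
      intro η _
      simp [hK1]
    have d1 : DifferentiableOn ℂ (fun _ : ℂ => (1:ℂ)) Strip := differentiableOn_const _
    have t1 := thin_lim hδ (by positivity : 0 ≤ M * C) hkd hkb hh hK hB hl hl2 hv
    have t2 := thin_lim hδ hC0 hκd hκb (h := fun _ => 1) (K := K1) (l := l) (v := fun _ => 1)
      d1 hK1t hB1 hl hl2 (fun φ => tendsto_const_nhds)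
    simp only [one_mul] at t2
    have t3 := t1.sub (t2.const_mul (F z0))
    refine tendsto_nhds_unique (tendsto_const_nhds (f := l)) (t3.congr' ?_)
    filter_upwards [hl2, hl (Metric.ball_mem_nhds y hδ)] with η h1 h2
    rw [Metric.mem_ball, Real.dist_eq] at h2
    have hin : ∀ x : ℝ, (x:ℂ) + η * I ∈ Thin y δ := fun x => by simpa [Thin] using h2
    have cκ : Continuous (fun x : ℝ => (dd α (x + η * I))⁻¹) := by
      rw [← continuousOn_univ]
      exact hκd.continuousOn.comp (by fun_prop) fun x _ => hin x
    have ck : Continuous (fun x : ℝ => n (x + η * I) * (dd α (x + η * I))⁻¹) := by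
      rw [← continuousOn_univ]
      exact hkd.continuousOn.comp (f := fun x : ℝ => (x:ℂ) + η * I) (by fun_prop) fun x _ => hin x
    have i1 := (wt_mul_integrable hh hK h1 (hB η h1) ck.aestronglyMeasurable (by positivity : 0 ≤ M * C)
      (fun x => by simpa using hkb _ (hin x))).1
    have i2 := (wt_mul_integrable d1 hK1t h1 (hB1 η h1) cκ.aestronglyMeasurable hC0
      (fun x => by simpa using hκb _ (hin x))).1
    simp only [one_mul] at i2
    rw [← const η h1, ← integral_const_mul, ← integral_sub i1 (i2.const_mul _)]
    congr 1
    ext x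
    rw [hTe _ (hGne _ (hG (hin x))), hF]
    ring
  have k0 := key 0 (𝓝[>] 0) v0 (fun z hz => Or.inl (by
      have : |z.im - 0| < δ := hz
      rw [sub_zero] at this; exact this.le)) (fun z hz => by
      have : |z.im - 0| < δ := hz
      rw [sub_zero, abs_lt] at this
      exact ⟨this.1, by linarith [this.2]⟩) nhdsWithin_le_nhds
      (Ioo_mem_nhdsGT one_pos) hv0
  have k1 := key 1 (𝓝[<] 1) v1 (fun z hz => Or.inr (Or.inl (by
      have : |z.im - 1| < δ := hz
      exact this.le))) (fun z hz => by
      have : |z.im - 1| < δ := hz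
      rw [abs_lt] at this
      exact ⟨by linarith [this.1], by linarith [this.2]⟩) nhdsWithin_le_nhds
      (Ioo_mem_nhdsLT one_pos) hv1
  simp only [ofReal_zero, zero_mul, add_zero, ofReal_one, one_mul] at k0 k1
  have j0 : ∫ x : ℝ, (dd α x)⁻¹ = ((∫ x : ℝ, (Real.cosh (π * x) - Real.cos (π * α))⁻¹ : ℝ) : ℂ) := by
    rw [← integral_complex_ofReal]
    congr 1; ext x; rw [dd_line0, ofReal_inv]
  have j1 : ∫ x : ℝ, (dd α (x + I))⁻¹ =
      -((∫ x : ℝ, (Real.cosh (π * x) - Real.cos (π * (1 - α)))⁻¹ : ℝ) : ℂ) := by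
    rw [← integral_complex_ofReal, ← integral_neg]
    congr 1; ext x; rw [dd_line1, ofReal_inv, ofReal_neg, inv_neg]
  rw [j0] at k0
  rw [j1] at k1
  push_cast
  change F z0 * _ = _
  linear_combination k0 - k1

lemma holder_int {p : ℝ≥0∞} (hp : 1 ≤ p) {A : ℝ → ℝ} (hA : ∀ x, 0 < A x)
    (hI : Integrable (fun x => (A x)⁻¹)) {v k : ℝ → ℂ} (hv : MemLp v p volume) (hk : Continuous k)
    {N : ℝ} (hN : 0 ≤ N) (hkb : ∀ x, ‖k x‖ ≤ N * (A x) ^ ((p⁻¹).toReal - 1)) :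
    ‖∫ x, v x * k x‖ ≤ (eLpNorm v p volume).toReal * (N * (∫ x, (A x)⁻¹) ^ (1 - (p⁻¹).toReal)) := by
  obtain ⟨p', hp', hc, he⟩ := exists_conj hp
  have h1 := (enorm_integral_le_lintegral_enorm (fun x => v x * k x)).trans
    (holder_lint hc hv.1 hk.aestronglyMeasurable)
  have h2 := eLpNorm_weight hp' hA hI (f := k) hN (fun x => by
    rw [he, neg_sub]; exact hkb x)
  have h3 := h1.trans (mul_le_mul_right h2 _)
  have h4 := ENNReal.toReal_mono (ENNReal.mul_lt_top hv.2 ENNReal.ofReal_lt_top).ne h3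
  have hm : 0 ≤ ∫ x, (A x)⁻¹ := integral_nonneg fun x => (inv_pos.2 (hA x)).le
  rwa [ENNReal.toReal_mul, ENNReal.toReal_ofReal (by positivity), toReal_enorm, he] at h4

lemma core_bound {α : ℝ} (hα : α ∈ Ioo (0:ℝ) 1) {p q : ℝ≥0∞} (hp : 1 ≤ p) (hq : 1 ≤ q)
    {h : ℂ → ℂ} (hh : DifferentiableOn ℂ h Strip)
    {K : ℝ≥0∞} (hK : K < ⊤)
    (hB : ∀ η ∈ Ioo (0:ℝ) 1, ∫⁻ x : ℝ, ‖h (x + η * I)‖ₑ * ENNReal.ofReal (Real.exp (-|x|)) ≤ K)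
    {v0 v1 : ℝ → ℂ} (hv0 : IsTrace0 h v0) (hv1 : IsTrace1 h v1)
    (hm0 : MemLp v0 p volume) (hm1 : MemLp v1 q volume) {n : ℂ → ℂ}
    (hn : DifferentiableOn ℂ n (Dst (min α (1-α) / 2))) {M : ℝ} (hM : 0 ≤ M)
    (hnM : ∀ z ∈ Dst (min α (1-α) / 2), ‖n z‖ ≤ M) {N0 N1 : ℝ} (hN0 : 0 ≤ N0) (hN1 : 0 ≤ N1)
    (hb0 : ∀ x : ℝ, ‖n x‖ ≤ N0 * (Real.cosh (π * x) - Real.cos (π * α)) ^ (p⁻¹).toReal)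
    (hb1 : ∀ x : ℝ, ‖n (x + I)‖ ≤ N1 * (Real.cosh (π * x) - Real.cos (π * (1 - α))) ^ (q⁻¹).toReal) :
    ‖h (α * I)‖ * ‖n (α * I)‖ * ((∫ x : ℝ, (Real.cosh (π * x) - Real.cos (π * α))⁻¹) +
      (∫ x : ℝ, (Real.cosh (π * x) - Real.cos (π * (1 - α)))⁻¹)) ≤
    (eLpNorm v0 p volume).toReal * (N0 * (∫ x : ℝ, (Real.cosh (π * x) - Real.cos (π * α))⁻¹) ^ (1 - (p⁻¹).toReal))
    + (eLpNorm v1 q volume).toReal *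
      (N1 * (∫ x : ℝ, (Real.cosh (π * x) - Real.cos (π * (1 - α)))⁻¹) ^ (1 - (q⁻¹).toReal)) := by
  have hα' : 1 - α ∈ Ioo (0:ℝ) 1 := ⟨by linarith [hα.2], by linarith [hα.1]⟩
  have hδ : 0 < min α (1-α) / 2 := by have := lt_min hα.1 (sub_pos.2 hα.2); linarith
  have id := congrArg norm (core_id hα hh hK hB hv0 hv1 hn hM hnM)
  have m0 : 0 ≤ ∫ x : ℝ, (Real.cosh (π * x) - Real.cos (π * α))⁻¹ :=
    integral_nonneg fun x => (inv_pos.2 (A_pos hα x)).le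
  have m1 : 0 ≤ ∫ x : ℝ, (Real.cosh (π * x) - Real.cos (π * (1 - α)))⁻¹ :=
    integral_nonneg fun x => (inv_pos.2 (A_pos hα' x)).le
  rw [norm_mul, norm_mul, Complex.norm_real, Real.norm_eq_abs, abs_of_nonneg (add_nonneg m0 m1)] at id
  rw [id]
  refine (norm_sub_le _ _).trans (add_le_add ?_ ?_)
  · refine holder_int hp (A_pos hα) (integrable_A hα) hm0 ?_ hN0 fun x => ?_
    · apply Continuous.mul
      · rw [← continuousOn_univ]
        exact hn.continuousOn.comp (f := fun x : ℝ => (x:ℂ)) (by fun_prop) fun x _ =>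
          ⟨by simpa using hδ, by simp; linarith⟩
      · apply Continuous.inv₀
        · exact (dd_diff α).continuous.comp Complex.continuous_ofReal
        · intro x; rw [dd_line0, ofReal_ne_zero]; exact (A_pos hα x).ne'
    · rw [norm_mul, dd_line0, norm_inv, Complex.norm_real, Real.norm_eq_abs, abs_of_pos (A_pos hα x),
        Real.rpow_sub_one (A_pos hα x).ne', div_eq_mul_inv, ← mul_assoc]
      exact mul_le_mul_of_nonneg_right (hb0 x) (inv_pos.2 (A_pos hα x)).le
  · refine holder_int hq (A_pos hα') (integrable_A hα') hm1 ?_ hN1 fun x => ?_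
    · apply Continuous.mul
      · rw [← continuousOn_univ]
        exact hn.continuousOn.comp (f := fun x : ℝ => (x:ℂ) + I) (by fun_prop) fun x _ =>
          ⟨by rw [add_im, ofReal_im, I_im]; linarith, by rw [add_im, ofReal_im, I_im]; linarith⟩
      · apply Continuous.inv₀
        · exact (dd_diff α).continuous.comp (by fun_prop)
        · intro x; rw [dd_line1, ofReal_ne_zero]; exact (neg_neg_of_pos (A_pos hα' x)).ne
    · rw [norm_mul, dd_line1, norm_inv, Complex.norm_real, Real.norm_eq_abs, abs_neg, abs_of_pos (A_pos hα' x),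
        Real.rpow_sub_one (A_pos hα' x).ne', div_eq_mul_inv, ← mul_assoc]
      exact mul_le_mul_of_nonneg_right (hb1 x) (inv_pos.2 (A_pos hα' x)).le

/-- a pair of outer functions adapted to the two boundary lines -/
structure OutPair (α : ℝ) (Φ Ψ : ℂ → ℂ) (c0 c1 C : ℝ) : Prop where
  c0pos : 0 < c0
  c1pos : 0 < c1
  Cnonneg : 0 ≤ C
  dΦ : DifferentiableOn ℂ Φ (Dst (min α (1-α) / 2))
  dΨ : DifferentiableOn ℂ Ψ (Dst (min α (1-α) / 2))
  Φ0 : ∀ x : ℝ, (Φ x).re = Real.log (c0 * (Real.cosh (π * x) - Real.cos (π * α)))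
  Φ1 : ∀ x : ℝ, (Φ (x + I)).re = 0
  Ψ0 : ∀ x : ℝ, (Ψ x).re = 0
  Ψ1 : ∀ x : ℝ, (Ψ (x + I)).re = Real.log (c1 * (Real.cosh (π * x) - Real.cos (π * (1 - α))))
  bΦ : ∀ z ∈ Dst (min α (1-α) / 2), |(Φ z).re| ≤ C * (1 + |z.re|)
  bΨ : ∀ z ∈ Dst (min α (1-α) / 2), |(Ψ z).re| ≤ C * (1 + |z.re|)

lemma exists_pair {α : ℝ} (hα : α ∈ Ioo (0:ℝ) 1) : ∃ Φ Ψ c0 c1 C, OutPair α Φ Ψ c0 c1 C := by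
  have hα' : 1 - α ∈ Ioo (0:ℝ) 1 := ⟨by linarith [hα.2], by linarith [hα.1]⟩
  obtain ⟨Φ, c0, hc0, C0, hC0, d0, e1, e0, b0⟩ := exists_outer α hα
  obtain ⟨Ψ, c1, hc1, C1, hC1, d1, f1, f0, b1⟩ := exists_outer (1-α) hα'
  have m1 : min α (1-α) ≤ α := min_le_left _ _
  have m2 : min α (1-α) ≤ 1 - α := min_le_right _ _
  have s0 : Dst (min α (1-α) / 2) ⊆ Dst (α/2) := fun z hz => ⟨by linarith [hz.1], by linarith [hz.2]⟩
  have s1 : MapsTo (fun z : ℂ => I - z) (Dst (min α (1-α) / 2)) (Dst ((1-α)/2)) := fun z hz => by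
    constructor
    · simp only [sub_im, I_im]; linarith [hz.2]
    · simp only [sub_im, I_im]; linarith [hz.1]
  refine ⟨Φ, fun z => Ψ (I - z), c0, c1, max C0 C1, hc0, hc1, hC0.trans (le_max_left _ _), d0.mono s0,
    d1.comp (by fun_prop) s1, e0, e1, fun x => ?_, fun x => ?_, fun z hz => ?_, fun z hz => ?_⟩
  · have := f1 (-x)
    rw [← this]; congr 2; push_cast; ring
  · have := f0 (-x)
    rw [mul_neg, Real.cosh_neg] at this
    rw [← this]; congr 2; push_cast; ring
  · refine (b0 z (s0 hz)).trans ?_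
    gcongr; exact le_max_left _ _
  · refine (b1 _ (s1 hz)).trans ?_
    simp only [sub_re, I_re, zero_sub, abs_neg]
    gcongr; exact le_max_right _ _

lemma m_pos {α : ℝ} (hα : α ∈ Ioo (0:ℝ) 1) :
    0 < ∫ x : ℝ, (Real.cosh (π * x) - Real.cos (π * α))⁻¹ := by
  rw [integral_pos_iff_support_of_nonneg (fun x => (inv_pos.2 (A_pos hα x)).le) (integrable_A hα)]
  have : Function.support (fun x : ℝ => (Real.cosh (π * x) - Real.cos (π * α))⁻¹) = univ := by
    ext x; simpa using (A_pos hα x).ne'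
  rw [this]; simp

/-- the exponent of the extremal multiplier -/
def ex (Φ Ψ : ℂ → ℂ) (P Q ε s : ℝ) (z : ℂ) : ℂ :=
  P * Φ z + Q * Ψ z - ε * z ^ 2 - I * s * z

lemma ex_re (Φ Ψ : ℂ → ℂ) (P Q ε s : ℝ) (z : ℂ) : (ex Φ Ψ P Q ε s z).re =
    P * (Φ z).re + Q * (Ψ z).re - ε * (z.re ^ 2 - z.im ^ 2) + s * z.im := by
  simp [ex, sq]

lemma ex_bound {α : ℝ} (hα : α ∈ Ioo (0:ℝ) 1) {Φ Ψ c0 c1 C} (hO : OutPair α Φ Ψ c0 c1 C) {P Q ε s : ℝ}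
    (hP : |P| ≤ 1) (hQ : |Q| ≤ 1) (hε : 0 < ε) :
    ∃ M, 0 ≤ M ∧ ∀ z ∈ Dst (min α (1-α) / 2), ‖Complex.exp (ex Φ Ψ P Q ε s z)‖ ≤ M * Real.exp (-|z.re|) := by
  refine ⟨Real.exp (2 * C + (2*C+1)^2 / (4*ε) + 4 * ε + 2 * |s|), (Real.exp_pos _).le, fun z hz => ?_⟩
  rw [Complex.norm_exp, ex_re, ← Real.exp_add]
  apply Real.exp_le_exp.2
  have h1 := hO.bΦ z hz
  have h2 := hO.bΨ z hz
  have hC := hO.Cnonneg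
  have p1 : P * (Φ z).re ≤ C * (1 + |z.re|) := by
    calc P * (Φ z).re ≤ |P * (Φ z).re| := le_abs_self _
      _ = |P| * |(Φ z).re| := abs_mul _ _
      _ ≤ 1 * (C * (1 + |z.re|)) := by gcongr
      _ = _ := one_mul _
  have p2 : Q * (Ψ z).re ≤ C * (1 + |z.re|) := by
    calc Q * (Ψ z).re ≤ |Q * (Ψ z).re| := le_abs_self _
      _ = |Q| * |(Ψ z).re| := abs_mul _ _
      _ ≤ 1 * (C * (1 + |z.re|)) := by gcongr
      _ = _ := one_mul _
  have mm : min α (1-α) ≤ α := min_le_left _ _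
  have him : |z.im| ≤ 2 := by
    rw [abs_le]; constructor <;> linarith [hz.1, hz.2, hα.1, hα.2]
  have p3 : s * z.im ≤ 2 * |s| := by
    calc s * z.im ≤ |s * z.im| := le_abs_self _
      _ = |s| * |z.im| := abs_mul _ _
      _ ≤ |s| * 2 := by gcongr
      _ = _ := mul_comm _ _
  have p4 : z.im ^ 2 ≤ 4 := by
    rw [← sq_abs]; nlinarith [abs_nonneg z.im]
  have p5 : (2 * C + 1) * |z.re| - ε * z.re ^ 2 ≤ (2*C+1)^2 / (4*ε) := by
    rw [le_div_iff₀ (by positivity), ← sq_abs z.re]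
    nlinarith [sq_nonneg (2 * ε * |z.re| - (2*C+1))]
  nlinarith

lemma ex_diff {α : ℝ} {Φ Ψ c0 c1 C} (hO : OutPair α Φ Ψ c0 c1 C) (P Q ε s : ℝ) :
    DifferentiableOn ℂ (fun z => Complex.exp (ex Φ Ψ P Q ε s z)) (Dst (min α (1-α) / 2)) := by
  have := hO.dΦ
  have := hO.dΨ
  unfold ex
  fun_prop

lemma ex_zero {α : ℝ} (hα : α ∈ Ioo (0:ℝ) 1) {Φ Ψ c0 c1 C} (hO : OutPair α Φ Ψ c0 c1 C) {P Q ε s : ℝ}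
    (x : ℝ) : ‖Complex.exp (ex Φ Ψ P Q ε s x)‖ = c0 ^ P * (Real.cosh (π * x) - Real.cos (π * α)) ^ P *
      Real.exp (-(ε * x ^ 2)) := by
  have hA := A_pos hα x
  rw [Complex.norm_exp, ex_re, hO.Φ0, hO.Ψ0, ← Real.mul_rpow hO.c0pos.le hA.le,
    Real.rpow_def_of_pos (mul_pos hO.c0pos hA), ← Real.exp_add]
  congr 1
  simp
  ring

lemma ex_one {α : ℝ} (hα : α ∈ Ioo (0:ℝ) 1) {Φ Ψ c0 c1 C} (hO : OutPair α Φ Ψ c0 c1 C) {P Q ε s : ℝ}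
    (x : ℝ) : ‖Complex.exp (ex Φ Ψ P Q ε s (x + I))‖ =
      c1 ^ Q * (Real.cosh (π * x) - Real.cos (π * (1 - α))) ^ Q *
      Real.exp (-(ε * x ^ 2) + (ε + s)) := by
  have hα' : 1 - α ∈ Ioo (0:ℝ) 1 := ⟨by linarith [hα.2], by linarith [hα.1]⟩
  have hA := A_pos hα' x
  rw [Complex.norm_exp, ex_re, hO.Φ1, hO.Ψ1, ← Real.mul_rpow hO.c1pos.le hA.le,
    Real.rpow_def_of_pos (mul_pos hO.c1pos hA), ← Real.exp_add]
  congr 1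
  simp
  ring

lemma ex_mid (Φ Ψ : ℂ → ℂ) (P Q ε s α : ℝ) : ‖Complex.exp (ex Φ Ψ P Q ε s (α * I))‖ =
    Real.exp (P * (Φ (α * I)).re + Q * (Ψ (α * I)).re + ε * α ^ 2 + s * α) := by
  rw [Complex.norm_exp, ex_re]
  congr 1
  simp

lemma upper_zero {α : ℝ} (hα : α ∈ Ioo (0:ℝ) 1) {Φ Ψ c0 c1 C} (hO : OutPair α Φ Ψ c0 c1 C)
    {p q : ℝ≥0∞} (hp : 1 ≤ p) (hq : 1 ≤ q)
    {h : ℂ → ℂ} (hh : DifferentiableOn ℂ h Strip)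
    {K : ℝ≥0∞} (hK : K < ⊤)
    (hB : ∀ η ∈ Ioo (0:ℝ) 1, ∫⁻ x : ℝ, ‖h (x + η * I)‖ₑ * ENNReal.ofReal (Real.exp (-|x|)) ≤ K)
    {v0 v1 : ℝ → ℂ} (hv0 : IsTrace0 h v0) (hv1 : IsTrace1 h v1)
    (hm0 : MemLp v0 p volume) (hm1 : MemLp v1 q volume)
    {m0 m1 a b P Q : ℝ} (em0 : m0 = ∫ x : ℝ, (Real.cosh (π * x) - Real.cos (π * α))⁻¹)
    (em1 : m1 = ∫ x : ℝ, (Real.cosh (π * x) - Real.cos (π * (1 - α)))⁻¹)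
    (ea : a = (eLpNorm v0 p volume).toReal) (eb : b = (eLpNorm v1 q volume).toReal)
    (eP : P = (p⁻¹).toReal) (eQ : Q = (q⁻¹).toReal) (ha : 0 < a) (hb : 0 < b) :
    ‖h (α * I)‖ ≤ Real.exp (-(P * (Φ (α * I)).re + Q * (Ψ (α * I)).re)) *
      ((a * (c0 / m0) ^ P) ^ (1 - α) * (b * (c1 / m1) ^ Q) ^ α) := by
  have hα' : 1 - α ∈ Ioo (0:ℝ) 1 := ⟨by linarith [hα.2], by linarith [hα.1]⟩
  have hm0p : 0 < m0 := em0 ▸ m_pos hα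
  have hm1p : 0 < m1 := em1 ▸ m_pos hα'
  have hc0 := hO.c0pos
  have hc1 := hO.c1pos
  set W := P * (Φ (α * I)).re + Q * (Ψ (α * I)).re with hW
  set a' := a * (c0 / m0) ^ P with ha'
  set b' := b * (c1 / m1) ^ Q with hb'
  have pa : 0 < a' := by positivity
  have pb : 0 < b' := by positivity
  have hP0 : 0 ≤ P := eP ▸ ENNReal.toReal_nonneg
  have hQ0 : 0 ≤ Q := eQ ▸ ENNReal.toReal_nonneg
  have hP1 : |P| ≤ 1 := by rw [abs_of_nonneg hP0, eP]; exact toReal_inv_le_one hp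
  have hQ1 : |Q| ≤ 1 := by rw [abs_of_nonneg hQ0, eQ]; exact toReal_inv_le_one hq
  have main : ∀ ε : ℝ, 0 < ε → ‖h (α * I)‖ ≤ Real.exp (-W) * (a' ^ (1 - α) * b' ^ α) *
      Real.exp (ε * (α * (1 - α))) := by
    intro ε hε
    set s := Real.log a' - Real.log b' - ε with hs
    obtain ⟨M, hM0, hM⟩ := ex_bound (s := s) hα hO hP1 hQ1 hε
    have cb := core_bound hα hp hq hh hK hB hv0 hv1 hm0 hm1 (ex_diff hO P Q ε s) hM0
      (fun z hz => (hM z hz).trans (by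
        apply mul_le_of_le_one_right hM0
        rw [Real.exp_le_one_iff]; simp)) (N0 := c0 ^ P) (N1 := c1 ^ Q * Real.exp (ε + s))
      (by positivity) (by positivity)
      (fun x => by
        rw [ex_zero hα hO, ← eP]
        apply mul_le_of_le_one_right
        · have := A_pos hα x
          positivity
        · rw [Real.exp_le_one_iff]; have := sq_nonneg x; nlinarith)
      (fun x => by
        rw [ex_one hα hO, ← eQ, mul_right_comm]
        have := A_pos hα' x
        refine mul_le_mul_of_nonneg_right (mul_le_mul_of_nonneg_left (Real.exp_le_exp.2 ?_)
          (by positivity)) (by positivity)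
        have := sq_nonneg x; nlinarith)
    rw [ex_mid, ← em0, ← em1, ← ea, ← eb, ← eP, ← eQ, ← hW] at cb
    have es : Real.exp (ε + s) = a' / b' := by
      rw [hs, show ε + (Real.log a' - Real.log b' - ε) = Real.log a' - Real.log b' by ring, Real.exp_sub,
        Real.exp_log pa, Real.exp_log pb]
    have r0 : a * (c0 ^ P * m0 ^ (1 - P)) = a' * m0 := by
      rw [ha', Real.rpow_sub hm0p, Real.rpow_one, Real.div_rpow hc0.le hm0p.le]; ring
    have r1 : b * (c1 ^ Q * Real.exp (ε + s) * m1 ^ (1 - Q)) = a' * m1 := by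
      have : b * (c1 ^ Q * Real.exp (ε + s) * m1 ^ (1 - Q)) = b' * Real.exp (ε + s) * m1 := by
        rw [hb', Real.rpow_sub hm1p, Real.rpow_one, Real.div_rpow hc1.le hm1p.le]; ring
      rw [this, es, mul_div_cancel₀ _ pb.ne']
    rw [r0, r1, ← mul_add] at cb
    have cb2 := le_of_mul_le_mul_right cb (add_pos hm0p hm1p)
    rw [← le_div_iff₀ (Real.exp_pos _)] at cb2
    refine cb2.trans (le_of_eq ?_)
    rw [div_eq_mul_inv, ← Real.exp_neg, Real.rpow_def_of_pos pa, Real.rpow_def_of_pos pb]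
    nth_rewrite 1 [← Real.exp_log pa]
    rw [← Real.exp_add, ← Real.exp_add, ← Real.exp_add, ← Real.exp_add]
    congr 1
    rw [hs]; ring
  have lim : Tendsto (fun ε : ℝ => Real.exp (-W) * (a' ^ (1 - α) * b' ^ α) *
      Real.exp (ε * (α * (1 - α)))) (𝓝[>] 0) (𝓝 (Real.exp (-W) * (a' ^ (1 - α) * b' ^ α) *
      Real.exp (0 * (α * (1 - α))))) := by
    apply Tendsto.mono_left _ nhdsWithin_le_nhds
    apply Continuous.tendsto; fun_prop
  rw [zero_mul, Real.exp_zero, mul_one] at lim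
  exact ge_of_tendsto lim (by filter_upwards [self_mem_nhdsWithin] with ε hε using main ε hε)

lemma trans_trace {h : ℂ → ℂ} {v : ℝ → ℂ} {l : Filter ℝ} (x0 : ℝ)
    (hv : ∀ φ : SchwartzMap ℝ ℂ,
      Tendsto (fun y : ℝ => ∫ x : ℝ, h (x + y * Complex.I) * (starRingEnd ℂ) (φ x))
      l (𝓝 (∫ x : ℝ, v x * (starRingEnd ℂ) (φ x)))) :
    ∀ φ : SchwartzMap ℝ ℂ,
      Tendsto (fun y : ℝ => ∫ x : ℝ, h (x + y * Complex.I + x0) * (starRingEnd ℂ) (φ x))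
      l (𝓝 (∫ x : ℝ, v (x + x0) * (starRingEnd ℂ) (φ x))) := by
  intro φ
  have := hv (φ.compSubConstCLM ℂ x0)
  simp only [SchwartzMap.compSubConstCLM_apply] at this
  have e1 : ∫ x : ℝ, v (x + x0) * (starRingEnd ℂ) (φ x) = ∫ x : ℝ, v x * (starRingEnd ℂ) (φ (x - x0)) := by
    rw [← integral_add_right_eq_self (fun x : ℝ => v x * (starRingEnd ℂ) (φ (x - x0))) x0]
    simp
  rw [e1]
  refine this.congr fun y => ?_
  rw [← integral_add_right_eq_self (fun x : ℝ => h (x + y * I) * (starRingEnd ℂ) (φ (x - x0))) x0]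
  congr 1; ext x
  simp only [add_sub_cancel_right, ofReal_add]
  congr 2; ring

/-- the extremal value -/
def GG (α : ℝ) (Φ Ψ : ℂ → ℂ) (c0 c1 P Q : ℝ) : ℝ :=
  Real.exp (-(P * (Φ (α * I)).re + Q * (Ψ (α * I)).re)) *
   (((c0 / ∫ x : ℝ, (Real.cosh (π * x) - Real.cos (π * α))⁻¹) ^ P) ^ (1 - α) *
    ((c1 / ∫ x : ℝ, (Real.cosh (π * x) - Real.cos (π * (1 - α)))⁻¹) ^ Q) ^ α)

lemma GG_pos {α : ℝ} (hα : α ∈ Ioo (0:ℝ) 1) {Φ Ψ c0 c1 C} (hO : OutPair α Φ Ψ c0 c1 C) (P Q : ℝ) :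
    0 < GG α Φ Ψ c0 c1 P Q := by
  have hα' : 1 - α ∈ Ioo (0:ℝ) 1 := ⟨by linarith [hα.2], by linarith [hα.1]⟩
  have := m_pos hα
  have := m_pos hα'
  have hc0 := hO.c0pos
  have hc1 := hO.c1pos
  unfold GG
  positivity

lemma ratio_le {α : ℝ} (hα : α ∈ Ioo (0:ℝ) 1) {Φ Ψ c0 c1 C} (hO : OutPair α Φ Ψ c0 c1 C)
    {p q : ℝ≥0∞} (hp : 1 ≤ p) (hq : 1 ≤ q) {r : ℝ} (hr : r ∈ ratioSet p q α) :
    r ≤ GG α Φ Ψ c0 c1 (p⁻¹).toReal (q⁻¹).toReal := by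
  have hα' : 1 - α ∈ Ioo (0:ℝ) 1 := ⟨by linarith [hα.2], by linarith [hα.1]⟩
  obtain ⟨h, v0, v1, hh, -, hv0, hv1, hm0, hm1, rfl⟩ := hr
  have hG := GG_pos hα hO (p⁻¹).toReal (q⁻¹).toReal
  set a := (eLpNorm v0 p volume).toReal with ha
  set b := (eLpNorm v1 q volume).toReal with hb
  have hann : 0 ≤ a := ENNReal.toReal_nonneg
  have hbnn : 0 ≤ b := ENNReal.toReal_nonneg
  rcases hann.eq_or_lt with ha0 | ha0
  · rw [← ha0, Real.zero_rpow hα'.1.ne']; simpa using hG.le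
  rcases hbnn.eq_or_lt with hb0 | hb0
  · rw [← hb0, Real.zero_rpow hα.1.ne']; simpa using hG.le
  obtain ⟨K, hK, hB⟩ := hardy_bound hp hq hh
  have pt : ∀ x0 : ℝ, ‖h (x0 + α * I)‖ ≤ GG α Φ Ψ c0 c1 (p⁻¹).toReal (q⁻¹).toReal * (a ^ (1 - α) * b ^ α) := by
    intro x0
    have hd : DifferentiableOn ℂ (fun z => h (z + x0)) Strip := by
      refine hh.1.comp (by fun_prop) fun z hz => ?_
      simpa [Strip] using hz
    have hB' : ∀ η ∈ Ioo (0:ℝ) 1, ∫⁻ x : ℝ, ‖(fun z => h (z + x0)) (x + η * I)‖ₑ *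
        ENNReal.ofReal (Real.exp (-|x|)) ≤ ENNReal.ofReal (Real.exp |x0|) * K := by
      intro η hη
      refine le_trans ?_ (mul_le_mul_right (hB η hη) _)
      rw [← lintegral_const_mul' _ _ ENNReal.ofReal_ne_top,
        ← lintegral_add_right_eq_self (fun x : ℝ => ENNReal.ofReal (Real.exp |x0|) *
          (‖h (x + η * I)‖ₑ * ENNReal.ofReal (Real.exp (-|x|)))) x0]
      apply lintegral_mono
      intro x
      simp only
      rw [mul_left_comm, ← ENNReal.ofReal_mul (Real.exp_pos _).le, ← Real.exp_add,
        show (x:ℂ) + η * I + x0 = ((x + x0 : ℝ) : ℂ) + η * I by push_cast; ring]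
      gcongr
      have := abs_add_le x x0
      linarith
    have mp := measurePreserving_add_right (volume : Measure ℝ) x0
    have e0 : eLpNorm (fun x => v0 (x + x0)) p volume = eLpNorm v0 p volume :=
      eLpNorm_comp_measurePreserving hm0.1 mp
    have e1 : eLpNorm (fun x => v1 (x + x0)) q volume = eLpNorm v1 q volume :=
      eLpNorm_comp_measurePreserving hm1.1 mp
    have := upper_zero hα hO hp hq hd (ENNReal.mul_lt_top ENNReal.ofReal_lt_top hK) hB'
      (trans_trace x0 hv0) (trans_trace x0 hv1) (hm0.comp_measurePreserving mp)
      (hm1.comp_measurePreserving mp) rfl rfl (a := a) (b := b) (by rw [e0]) (by rw [e1]) rfl rfl ha0 hb0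
    rw [show (x0:ℂ) + α * I = α * I + x0 by ring]
    refine this.trans (le_of_eq ?_)
    have := m_pos hα
    have := m_pos hα'
    have hc0 := hO.c0pos
    have hc1 := hO.c1pos
    rw [Real.mul_rpow ha0.le (by positivity), Real.mul_rpow hb0.le (by positivity), GG]
    ring
  have hnum : (eLpNorm (bLine h α) ⊤ volume).toReal ≤
      GG α Φ Ψ c0 c1 (p⁻¹).toReal (q⁻¹).toReal * (a ^ (1 - α) * b ^ α) := by
    apply ENNReal.toReal_le_of_le_ofReal (by positivity)
    rw [eLpNorm_exponent_top]
    exact eLpNormEssSup_le_of_ae_bound (ae_of_all _ pt)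
  rwa [div_le_iff₀ (by positivity)]

lemma le_essSup {f : ℝ → ℂ} (hf : Continuous f) (x : ℝ) : ‖f x‖ₑ ≤ eLpNorm f ⊤ volume := by
  rw [eLpNorm_exponent_top]
  by_contra hcon
  rw [not_le] at hcon
  have ho : IsOpen {x | eLpNormEssSup f volume < ‖f x‖ₑ} := isOpen_lt continuous_const hf.enorm
  have hz : volume {x | eLpNormEssSup f volume < ‖f x‖ₑ} = 0 := by
    have := enorm_ae_le_eLpNormEssSup f (volume : Measure ℝ)
    rw [ae_iff] at this
    simpa using this
  replace hz := (ho.measure_eq_zero_iff (volume : Measure ℝ)).1 hz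
  have : x ∈ {x | eLpNormEssSup f volume < ‖f x‖ₑ} := hcon
  rw [hz] at this
  exact this

lemma eLp_ne_zero {p : ℝ≥0∞} (hp : 1 ≤ p) {f : ℝ → ℂ} (hf : Continuous f) (h0 : ∀ x, f x ≠ 0) :
    eLpNorm f p volume ≠ 0 := by
  intro h
  rw [eLpNorm_eq_zero_iff hf.aestronglyMeasurable (zero_lt_one.trans_le hp).ne'] at h
  have : ∀ᵐ x ∂(volume : Measure ℝ), False := by
    filter_upwards [h] with x hx using h0 x hx
  rw [ae_iff] at this
  simp at this

section
variable {h : ℂ → ℂ} {δ M : ℝ}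

lemma dst_line (hδ : 0 < δ) (hd : DifferentiableOn ℂ h (Dst δ)) {y : ℝ} (hy : y ∈ Icc (0:ℝ) 1) :
    Continuous (fun x : ℝ => h (x + y * I)) := by
  rw [← continuousOn_univ]
  refine hd.continuousOn.comp (f := fun x : ℝ => (x:ℂ) + y * I) (by fun_prop) fun x _ => ?_
  constructor
  · simp; linarith [hy.1]
  · simp; linarith [hy.2]

lemma dst_bound (hδ : 0 < δ) (hb : ∀ z ∈ Dst δ, ‖h z‖ ≤ M * Real.exp (-|z.re|)) {y : ℝ} (hy : y ∈ Icc (0:ℝ) 1)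
    (x : ℝ) : ‖h (x + y * I)‖ ≤ M * Real.exp (-|x|) := by
  have := hb (x + y * I) ⟨by simp; linarith [hy.1], by simp; linarith [hy.2]⟩
  simpa using this

lemma dst_hardy (hδ : 0 < δ) (hM : 0 ≤ M) (hd : DifferentiableOn ℂ h (Dst δ))
    (hb : ∀ z ∈ Dst δ, ‖h z‖ ≤ M * Real.exp (-|z.re|)) {p q : ℝ≥0∞} (hp : 1 ≤ p) (hq : 1 ≤ q) :
    MemHardy p q h := by
  refine ⟨hd.mono fun z hz => ⟨by linarith [hz.1], by linarith [hz.2]⟩, ?_⟩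
  set B1 := ENNReal.ofReal (M * (∫ x : ℝ, Real.exp (-|x|)) ^ (p⁻¹).toReal)
  set B2 := ENNReal.ofReal (M * (∫ x : ℝ, Real.exp (-|x|)) ^ (q⁻¹).toReal)
  have hlt : ENNReal.ofReal 2 * B1 + ENNReal.ofReal 2 * B2 < ⊤ :=
    ENNReal.add_lt_top.2 ⟨ENNReal.mul_lt_top ENNReal.ofReal_lt_top ENNReal.ofReal_lt_top,
      ENNReal.mul_lt_top ENNReal.ofReal_lt_top ENNReal.ofReal_lt_top⟩
  refine lt_of_le_of_lt (iSup₂_le fun y hy => ?_) hlt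
  have hy' : y ∈ Icc (0:ℝ) 1 := Ioo_subset_Icc_self hy
  have hm : Measurable (bLine h y) := (dst_line hδ hd hy').measurable
  have b1 : eLpNorm (bLine h y) p volume ≤ B1 := eLpNorm_wt_lt_top hp hM (dst_bound hδ hb hy')
  have b2 : eLpNorm (bLine h y) q volume ≤ B2 := eLpNorm_wt_lt_top hq hM (dst_bound hδ hb hy')
  rcases le_total y (1/2) with h' | h'
  · refine le_trans ?_ le_self_add
    refine iInf_le_of_le (bLine h y) ?_
    refine iInf_le_of_le 0 ?_
    refine iInf_le_of_le hm (iInf_le_of_le measurable_zero (iInf_le_of_le (add_zero _) ?_))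
    rw [eLpNorm_zero, mul_zero, add_zero]
    gcongr
    rw [inv_le_comm₀ (by linarith [hy.2]) (by norm_num)]; linarith
  · refine le_trans ?_ le_add_self
    refine iInf_le_of_le 0 ?_
    refine iInf_le_of_le (bLine h y) ?_
    refine iInf_le_of_le measurable_zero (iInf_le_of_le hm (iInf_le_of_le (zero_add _) ?_))
    rw [eLpNorm_zero, mul_zero, zero_add]
    gcongr
    rw [inv_le_comm₀ hy.1 (by norm_num)]; linarith

lemma dst_trace (hδ : 0 < δ) (hM : 0 ≤ M) (hd : DifferentiableOn ℂ h (Dst δ))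
    (hb : ∀ z ∈ Dst δ, ‖h z‖ ≤ M * Real.exp (-|z.re|)) {y : ℝ} (hy : y ∈ Icc (0:ℝ) 1) {l : Filter ℝ}
    [l.IsCountablyGenerated]
    (hl : l ≤ 𝓝 y) (hl2 : ∀ᶠ η in l, η ∈ Ioo (0:ℝ) 1) (φ : SchwartzMap ℝ ℂ) :
    Tendsto (fun y : ℝ => ∫ x : ℝ, h (x + y * Complex.I) * (starRingEnd ℂ) (φ x))
      l (𝓝 (∫ x : ℝ, h (x + y * I) * (starRingEnd ℂ) (φ x))) := by
  apply tendsto_integral_filter_of_dominated_convergence (fun x => M * ‖φ x‖)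
  · filter_upwards [hl2] with η hη
    exact ((dst_line hδ hd (Ioo_subset_Icc_self hη)).mul
      (Complex.continuous_conj.comp φ.continuous)).aestronglyMeasurable
  · filter_upwards [hl2] with η hη
    refine ae_of_all _ fun x => ?_
    rw [norm_mul, RCLike.norm_conj]
    gcongr
    refine (dst_bound hδ hb (Ioo_subset_Icc_self hη) x).trans ?_
    apply mul_le_of_le_one_right hM
    rw [Real.exp_le_one_iff]; simp
  · exact (φ.integrable.norm).const_mul M
  · refine ae_of_all _ fun x => ?_
    apply Tendsto.mul_const
    have hz : (x:ℂ) + y * I ∈ Dst δ := ⟨by simp; linarith [hy.1], by simp; linarith [hy.2]⟩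
    have hc : ContinuousAt h (x + y * I) := (hd.continuousOn).continuousAt ((isOpen_Dst δ).mem_nhds hz)
    have h2 : Tendsto (fun η : ℝ => (x:ℂ) + η * I) (𝓝 y) (𝓝 (x + y * I)) :=
      Continuous.tendsto (by fun_prop) y
    exact hc.tendsto.comp (h2.mono_left hl)

end

lemma ratio_ge {α : ℝ} (hα : α ∈ Ioo (0:ℝ) 1) {Φ Ψ c0 c1 C} (hO : OutPair α Φ Ψ c0 c1 C)
    {p q : ℝ≥0∞} (hp : 1 ≤ p) (hq : 1 ≤ q) {ε : ℝ} (hε : 0 < ε) :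
    ∃ r ∈ ratioSet p q α, GG α Φ Ψ c0 c1 (p⁻¹).toReal (q⁻¹).toReal * Real.exp (ε * (α ^ 2 - α)) ≤ r := by
  have hα' : 1 - α ∈ Ioo (0:ℝ) 1 := ⟨by linarith [hα.2], by linarith [hα.1]⟩
  have hδ : 0 < min α (1-α) / 2 := by have := lt_min hα.1 (sub_pos.2 hα.2); linarith
  set P := (p⁻¹).toReal with eP
  set Q := (q⁻¹).toReal with eQ
  have hP0 : 0 ≤ P := ENNReal.toReal_nonneg
  have hQ0 : 0 ≤ Q := ENNReal.toReal_nonneg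
  have hP1 : |-P| ≤ 1 := by rw [abs_neg, abs_of_nonneg hP0]; exact toReal_inv_le_one hp
  have hQ1 : |-Q| ≤ 1 := by rw [abs_neg, abs_of_nonneg hQ0]; exact toReal_inv_le_one hq
  set h : ℂ → ℂ := fun z => Complex.exp (ex Φ Ψ (-P) (-Q) ε 0 z) with hh
  obtain ⟨M, hM0, hM⟩ := ex_bound (s := 0) hα hO hP1 hQ1 hε
  have hd : DifferentiableOn ℂ h (Dst (min α (1-α) / 2)) := ex_diff hO (-P) (-Q) ε 0
  have z01 : (0:ℝ) ∈ Icc (0:ℝ) 1 := by simp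
  have o01 : (1:ℝ) ∈ Icc (0:ℝ) 1 := by simp
  have c0' := dst_line hδ hd z01
  have c1' := dst_line hδ hd o01
  have t0 := fun φ => dst_trace hδ hM0 hd hM z01 (l := 𝓝[>] 0) nhdsWithin_le_nhds (Ioo_mem_nhdsGT one_pos) φ
  have t1 := fun φ => dst_trace hδ hM0 hd hM o01 (l := 𝓝[<] 1) nhdsWithin_le_nhds (Ioo_mem_nhdsLT one_pos) φ
  simp only [ofReal_zero, zero_mul, add_zero, ofReal_one, one_mul] at c0' c1' t0 t1
  have hm0p := m_pos hα
  have hm1p := m_pos hα'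
  have hc0 := hO.c0pos
  have hc1 := hO.c1pos
  set m0 := ∫ x : ℝ, (Real.cosh (π * x) - Real.cos (π * α))⁻¹ with em0
  set m1 := ∫ x : ℝ, (Real.cosh (π * x) - Real.cos (π * (1 - α)))⁻¹ with em1
  have n0 : eLpNorm (fun x : ℝ => h x) p volume ≤ ENNReal.ofReal (c0 ^ (-P) * m0 ^ P) := by
    refine eLpNorm_weight hp (A_pos hα) (integrable_A hα) (by positivity) fun x => ?_
    rw [hh]; simp only
    rw [ex_zero hα hO, ← eP]
    apply mul_le_of_le_one_right
    · have := A_pos hα x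
      positivity
    · rw [Real.exp_le_one_iff]; have := sq_nonneg x; nlinarith
  have n1 : eLpNorm (fun x : ℝ => h (x + I)) q volume ≤ ENNReal.ofReal (c1 ^ (-Q) * Real.exp ε * m1 ^ Q) := by
    refine eLpNorm_weight hq (A_pos hα') (integrable_A hα') (by positivity) fun x => ?_
    rw [hh]; simp only
    rw [ex_one hα hO, ← eQ, mul_right_comm]
    have := A_pos hα' x
    refine mul_le_mul_of_nonneg_right (mul_le_mul_of_nonneg_left (Real.exp_le_exp.2 ?_)
      (by positivity)) (by positivity)
    have := sq_nonneg x; nlinarith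
  have l0 : MemLp (fun x : ℝ => h x) p volume := ⟨c0'.aestronglyMeasurable, n0.trans_lt ENNReal.ofReal_lt_top⟩
  have l1 : MemLp (fun x : ℝ => h (x + I)) q volume := ⟨c1'.aestronglyMeasurable, n1.trans_lt ENNReal.ofReal_lt_top⟩
  have a0 : 0 < (eLpNorm (fun x : ℝ => h x) p volume).toReal :=
    ENNReal.toReal_pos (eLp_ne_zero hp c0' fun x => Complex.exp_ne_zero _) l0.2.ne
  have b0 : 0 < (eLpNorm (fun x : ℝ => h (x + I)) q volume).toReal :=
    ENNReal.toReal_pos (eLp_ne_zero hq c1' fun x => Complex.exp_ne_zero _) l1.2.ne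
  have a1 := ENNReal.toReal_le_of_le_ofReal (by positivity) n0
  have b1 := ENNReal.toReal_le_of_le_ofReal (by positivity) n1
  refine ⟨_, ⟨h, fun x => h x, fun x => h (x + I), dst_hardy hδ hM0 hd hM hp hq,
    ⟨α * I, by simpa using (mem_strip_iff 0 α).2 hα, Complex.exp_ne_zero _⟩, t0, t1, l0, l1, rfl⟩, ?_⟩
  have hαc : α ∈ Icc (0:ℝ) 1 := Ioo_subset_Icc_self hα
  have num : Real.exp (-(P * (Φ (α * I)).re + Q * (Ψ (α * I)).re) + ε * α ^ 2) ≤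
      (eLpNorm (bLine h α) ⊤ volume).toReal := by
    have e := le_essSup (dst_line hδ hd hαc) 0
    have ft : eLpNorm (bLine h α) ⊤ volume ≠ ⊤ := by
      refine ((eLpNorm_wt_lt_top (p := ⊤) le_top hM0 (dst_bound hδ hM hαc)).trans_lt ENNReal.ofReal_lt_top).ne
    have e2 := ENNReal.toReal_mono ft e
    rw [toReal_enorm, ofReal_zero, zero_add] at e2
    refine le_trans (le_of_eq ?_) e2
    rw [hh]; simp only
    rw [ex_mid]
    congr 1; ring
  rw [le_div_iff₀ (by positivity)]
  refine le_trans ?_ num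
  have hG := GG_pos hα hO P Q
  calc GG α Φ Ψ c0 c1 P Q * Real.exp (ε * (α ^ 2 - α)) *
        ((eLpNorm (fun x : ℝ => h x) p volume).toReal ^ (1 - α) *
          (eLpNorm (fun x : ℝ => h (x + I)) q volume).toReal ^ α)
      ≤ GG α Φ Ψ c0 c1 P Q * Real.exp (ε * (α ^ 2 - α)) *
        ((c0 ^ (-P) * m0 ^ P) ^ (1 - α) * (c1 ^ (-Q) * Real.exp ε * m1 ^ Q) ^ α) := by
        have := hα.1.le
        have := hα'.1.le
        gcongr
    _ = Real.exp (-(P * (Φ (α * I)).re + Q * (Ψ (α * I)).re) + ε * α ^ 2) := by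
        rw [GG, ← em0, ← em1, Real.rpow_def_of_pos (by positivity : 0 < (c0 / m0) ^ P),
          Real.rpow_def_of_pos (by positivity : 0 < (c1 / m1) ^ Q),
          Real.rpow_def_of_pos (by positivity : 0 < c0 ^ (-P) * m0 ^ P),
          Real.rpow_def_of_pos (by positivity : 0 < c1 ^ (-Q) * Real.exp ε * m1 ^ Q),
          Real.log_mul (by positivity) (by positivity), Real.log_mul (by positivity) (by positivity),
          Real.log_mul (by positivity) (by positivity), Real.log_exp,
          Real.log_rpow (by positivity), Real.log_rpow (by positivity), Real.log_rpow (by positivity),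
          Real.log_rpow (by positivity), Real.log_rpow (by positivity), Real.log_rpow (by positivity),
          Real.log_div hc0.ne' hm0p.ne', Real.log_div hc1.ne' hm1p.ne']
        simp only [← Real.exp_add]
        congr 1
        ring

lemma Hval_eq {α : ℝ} (hα : α ∈ Ioo (0:ℝ) 1) {Φ Ψ c0 c1 C} (hO : OutPair α Φ Ψ c0 c1 C)
    {p q : ℝ≥0∞} (hp : 1 ≤ p) (hq : 1 ≤ q) :
    Hval p q α = GG α Φ Ψ c0 c1 (p⁻¹).toReal (q⁻¹).toReal := by
  have bdd : BddAbove (ratioSet p q α) := ⟨_, fun r hr => ratio_le hα hO hp hq hr⟩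
  apply le_antisymm
  · obtain ⟨r, hr, -⟩ := ratio_ge hα hO hp hq one_pos
    exact csSup_le ⟨r, hr⟩ fun r hr => ratio_le hα hO hp hq hr
  · set G := GG α Φ Ψ c0 c1 (p⁻¹).toReal (q⁻¹).toReal
    have lim : Tendsto (fun ε : ℝ => G * Real.exp (ε * (α ^ 2 - α))) (𝓝[>] 0)
        (𝓝 (G * Real.exp (0 * (α ^ 2 - α)))) := by
      apply Tendsto.mono_left _ nhdsWithin_le_nhds
      apply Continuous.tendsto; fun_prop
    rw [zero_mul, Real.exp_zero, mul_one] at lim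
    refine le_of_tendsto lim ?_
    filter_upwards [self_mem_nhdsWithin] with ε hε
    obtain ⟨r, hr, hle⟩ := ratio_ge hα hO hp hq hε
    exact hle.trans (le_csSup bdd hr)

lemma GG_exp {α : ℝ} (hα : α ∈ Ioo (0:ℝ) 1) {Φ Ψ c0 c1 C} (hO : OutPair α Φ Ψ c0 c1 C) :
    ∃ X Y : ℝ, ∀ P Q, GG α Φ Ψ c0 c1 P Q = Real.exp (P * X + Q * Y) := by
  have hα' : 1 - α ∈ Ioo (0:ℝ) 1 := ⟨by linarith [hα.2], by linarith [hα.1]⟩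
  have hm0p := m_pos hα
  have hm1p := m_pos hα'
  have hc0 := hO.c0pos
  have hc1 := hO.c1pos
  set m0 := ∫ x : ℝ, (Real.cosh (π * x) - Real.cos (π * α))⁻¹ with em0
  set m1 := ∫ x : ℝ, (Real.cosh (π * x) - Real.cos (π * (1 - α)))⁻¹ with em1
  refine ⟨-(Φ (α * I)).re + (1 - α) * Real.log (c0 / m0), -(Ψ (α * I)).re + α * Real.log (c1 / m1),
    fun P Q => ?_⟩
  rw [GG, ← em0, ← em1, Real.rpow_def_of_pos (by positivity : 0 < (c0 / m0) ^ P),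
    Real.rpow_def_of_pos (by positivity : 0 < (c1 / m1) ^ Q), Real.log_rpow (by positivity),
    Real.log_rpow (by positivity)]
  simp only [← Real.exp_add]
  congr 1
  ring

lemma interp_exp {p0 p1 pt : ℝ≥0∞} (h0 : 1 ≤ p0) (h1 : 1 ≤ p1) {t : ℝ} (ht : t ∈ Icc (0:ℝ) 1)
    (h : pt⁻¹ = ENNReal.ofReal (1 - t) * p0⁻¹ + ENNReal.ofReal t * p1⁻¹) :
    1 ≤ pt ∧ (pt⁻¹).toReal = (1 - t) * (p0⁻¹).toReal + t * (p1⁻¹).toReal := by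
  have i0 : p0⁻¹ ≤ 1 := by simpa using h0
  have i1 : p1⁻¹ ≤ 1 := by simpa using h1
  have ht' : 0 ≤ 1 - t := by linarith [ht.2]
  constructor
  · have : pt⁻¹ ≤ 1 := by
      rw [h]
      calc _ ≤ ENNReal.ofReal (1 - t) * 1 + ENNReal.ofReal t * 1 := by gcongr
        _ = 1 := by
          rw [mul_one, mul_one, ← ENNReal.ofReal_add ht' ht.1]; simp
    simpa using this
  · rw [h, ENNReal.toReal_add, ENNReal.toReal_mul, ENNReal.toReal_mul, ENNReal.toReal_ofReal ht',
      ENNReal.toReal_ofReal ht.1]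
    · exact (ENNReal.mul_lt_top ENNReal.ofReal_lt_top (i0.trans_lt ENNReal.one_lt_top)).ne
    · exact (ENNReal.mul_lt_top ENNReal.ofReal_lt_top (i1.trans_lt ENNReal.one_lt_top)).ne

/-- **Log linear relation** (Theorem 1.3): `(1/p, 1/q) ↦ log H_{p,q}(α)` is affine. -/
theorem log_linear_relation (α : ℝ) (hα : α ∈ Set.Ioo (0:ℝ) 1)
    (p₀ p₁ q₀ q₁ pt qt : ℝ≥0∞)
    (hp₀ : 1 ≤ p₀) (hp₁ : 1 ≤ p₁) (hq₀ : 1 ≤ q₀) (hq₁ : 1 ≤ q₁)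
    (t : ℝ) (ht : t ∈ Set.Icc (0:ℝ) 1)
    (hpt : pt⁻¹ = ENNReal.ofReal (1 - t) * p₀⁻¹ + ENNReal.ofReal t * p₁⁻¹)
    (hqt : qt⁻¹ = ENNReal.ofReal (1 - t) * q₀⁻¹ + ENNReal.ofReal t * q₁⁻¹) :
    Hval pt qt α = Hval p₀ q₀ α ^ (1 - t) * Hval p₁ q₁ α ^ t := by
  obtain ⟨Φ, Ψ, c0, c1, C, hO⟩ := exists_pair hα
  obtain ⟨hp, eP⟩ := interp_exp hp₀ hp₁ ht hpt
  obtain ⟨hq, eQ⟩ := interp_exp hq₀ hq₁ ht hqt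
  obtain ⟨X, Y, hG⟩ := GG_exp hα hO
  rw [Hval_eq hα hO hp hq, Hval_eq hα hO hp₀ hq₀, Hval_eq hα hO hp₁ hq₁, hG, hG, hG, eP, eQ,
    ← Real.exp_mul, ← Real.exp_mul, ← Real.exp_add]
  congr 1
  ring
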